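/- arXiv:2306.01994 — 2 statements merged into one kernel-verified Lean document; each statement's English description precedes it below -/
import Mathlib

section
/- Let (Γ, x_0) be a rooted tree of height h ≥ 1 and let t satisfy ⌈(h+1)/2⌉ ≤ t ≤ h+1. Then reg(R/I_t(Γ)) ≤ Σ_{x : h−t ≤ ℓ(x) ≤ h−2} deg⁺(x) + Σ_{i=t−1}^{h−2} (h−i−1)·l_i(Γ), where l_i(Γ) is the number of leaves of Γ at level i. -/
open MvPolynomial

structure MinFreeRes (k σ : Type) [Field k] (I : Ideal (MvPolynomial σ k)) where
  b : ℕ → ℕ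
  deg : (i : ℕ) → Fin (b i) → ℕ
  d : (i : ℕ) → ((Fin (b (i + 1)) → MvPolynomial σ k) →ₗ[MvPolynomial σ k]
        (Fin (b i) → MvPolynomial σ k))
  aug : (Fin (b 0) → MvPolynomial σ k) →ₗ[MvPolynomial σ k] (MvPolynomial σ k ⧸ I)
  aug_surjective : Function.Surjective aug
  exact_zero : Function.Exact (d 0) aug
  exact_succ : ∀ i : ℕ, Function.Exact (d (i + 1)) (d i)
  aug_homog : ∀ j : Fin (b 0), ∃ p : MvPolynomial σ k,
      p.IsHomogeneous (deg 0 j) ∧ aug (Pi.single j 1) = Ideal.Quotient.mk I p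
  d_homog : ∀ (i : ℕ) (j : Fin (b (i + 1))) (l : Fin (b i)),
      (d i (Pi.single j 1) l).IsHomogeneous (deg (i + 1) j - deg i l) ∧
        (deg (i + 1) j < deg i l → d i (Pi.single j 1) l = 0)
  minimal : ∀ (i : ℕ) (j : Fin (b (i + 1))) (l : Fin (b i)),
      MvPolynomial.constantCoeff (d i (Pi.single j 1) l) = 0

/-- The Castelnuovo-Mumford regularity of the module `R/I`, defined as the supremum of
`j - i` over the nonzero graded Betti numbers `β_{i,j}(R/I)`, read off from (any)
minimal graded free resolution of `R/I`. -/
noncomputable def reg (k σ : Type) [Field k] (I : Ideal (MvPolynomial σ k)) : ℤ :=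
  sSup {x : ℤ | ∃ F : MinFreeRes k σ I, ∃ i : ℕ, ∃ j : Fin (F.b i), x = (F.deg i j : ℤ) - i}

/-- A rooted tree on the vertex set `V`, encoded by the parent function (every edge is
directed away from the root). -/
structure RTree (V : Type) where
  root : V
  parent : V → V
  parent_root : parent root = root
  reach : ∀ v : V, ∃ n : ℕ, parent^[n] v = root

namespace RTree

variable {V : Type} [Fintype V] [DecidableEq V]

/-- The level of a vertex: its distance from the root. -/
noncomputable def level (T : RTree V) (v : V) : ℕ := Nat.find (T.reach v)

/-- The height of the rooted tree: the maximal level of a vertex. -/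
noncomputable def height (T : RTree V) : ℕ := Finset.univ.sup fun v => T.level v

/-- The outdegree of a vertex: its number of children. -/
noncomputable def outdeg (T : RTree V) (x : V) : ℕ :=
  Nat.card {y : V // T.parent y = x ∧ y ≠ T.root}

/-- A leaf is a vertex with no children. -/
def IsLeaf (T : RTree V) (x : V) : Prop := ∀ y : V, T.parent y = x → y = T.root

/-- A rooted tree is perfect if every leaf has level equal to the height. -/
def Perfect (T : RTree V) : Prop := ∀ x : V, T.IsLeaf x → T.level x = T.height

/-- The monomial of the directed path on `t` vertices ending at `v`
(valid when `level v ≥ t - 1`). -/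
noncomputable def pathMonomial (T : RTree V) (k : Type) [Field k] (t : ℕ) (v : V) :
    MvPolynomial V k := ∏ j ∈ Finset.range t, MvPolynomial.X (T.parent^[j] v)

/-- The `t`-path ideal `I_t(Γ)`: generated by the monomials of directed paths on
`t` vertices. -/
noncomputable def pathIdeal (T : RTree V) (k : Type) [Field k] (t : ℕ) :
    Ideal (MvPolynomial V k) :=
  Ideal.span {m | ∃ v : V, t ≤ T.level v + 1 ∧ m = T.pathMonomial k t v}

end RTree

namespace PI

section Graded
variable {k σ : Type} [Field k]


/-- A grading on a module over the polynomial ring, given by the projections onto components. -/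
structure Gr (k σ : Type) [Field k] (M : Type) [AddCommGroup M] [Module (MvPolynomial σ k) M] where
  π : ℕ → M →+ M
  orth : ∀ d e m, π d (π e m) = if d = e then π e m else 0
  smul : ∀ (a : ℕ) (p : MvPolynomial σ k), p.IsHomogeneous a → ∀ e m,
    π e (p • m) = if a ≤ e then p • π (e - a) m else 0

variable {M N A B C : Type} [AddCommGroup M] [Module (MvPolynomial σ k) M] [AddCommGroup N] [Module (MvPolynomial σ k) N]
  [AddCommGroup A] [Module (MvPolynomial σ k) A] [AddCommGroup B] [Module (MvPolynomial σ k) B] [AddCommGroup C] [Module (MvPolynomial σ k) C]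

/-- Graded maps of degree zero. -/
def GHom (g : Gr k σ M) (g' : Gr k σ N) (f : M →ₗ[(MvPolynomial σ k)] N) : Prop :=
  ∀ d m, f (g.π d m) = g'.π d (f m)

lemma GHom.comp {g : Gr k σ A} {g' : Gr k σ B} {g'' : Gr k σ C} {f : A →ₗ[(MvPolynomial σ k)] B} {f' : B →ₗ[(MvPolynomial σ k)] C}
    (h' : GHom g' g'' f') (h : GHom g g' f) : GHom g g'' (f' ∘ₗ f) := by
  intro d m
  simp [h d m, h' d]

/-- Restriction to a stable submodule. -/
noncomputable def Gr.sub (g : Gr k σ M) (S : Submodule (MvPolynomial σ k) M) (h : ∀ d, ∀ m ∈ S, g.π d m ∈ S) : Gr k σ S where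
  π d := ((g.π d).comp S.subtype.toAddMonoidHom).codRestrict S.toAddSubgroup
    (fun m => h d m m.2)
  orth d e m := by
    apply Subtype.ext
    have := g.orth d e m
    by_cases hde : d = e
    · simp only [hde, if_true] at this ⊢
      exact this
    · simp only [hde, if_false] at this ⊢
      exact this
  smul a p hp e m := by
    apply Subtype.ext
    have := g.smul a p hp e m
    by_cases hde : a ≤ e
    · simp only [hde, if_true] at this ⊢
      exact this
    · simp only [hde, if_false] at this ⊢
      exact this

lemma Gr.sub_coe (g : Gr k σ M) (S : Submodule (MvPolynomial σ k) M) (h : ∀ d, ∀ m ∈ S, g.π d m ∈ S) (d : ℕ)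
    (m : S) : (((g.sub S h).π d m : S) : M) = g.π d m := rfl

lemma Gr.sub_subtype (g : Gr k σ M) (S : Submodule (MvPolynomial σ k) M) (h : ∀ d, ∀ m ∈ S, g.π d m ∈ S) :
    GHom (g.sub S h) g S.subtype := fun _ _ => rfl

lemma ker_stable {g : Gr k σ M} {g' : Gr k σ N} {f : M →ₗ[(MvPolynomial σ k)] N} (h : GHom g g' f) :
    ∀ d, ∀ m ∈ LinearMap.ker f, g.π d m ∈ LinearMap.ker f := by
  intro d m hm
  rw [LinearMap.mem_ker] at *
  rw [h, hm, map_zero]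

lemma range_stable {g : Gr k σ M} {g' : Gr k σ N} {f : M →ₗ[(MvPolynomial σ k)] N} (h : GHom g g' f) :
    ∀ d, ∀ m ∈ LinearMap.range f, g'.π d m ∈ LinearMap.range f := by
  rintro d _ ⟨m, rfl⟩
  exact ⟨g.π d m, h d m⟩

noncomputable def Gr.prod (g : Gr k σ M) (g' : Gr k σ N) : Gr k σ (M × N) where
  π d := (g.π d).prodMap (g'.π d)
  orth d e m := by
    by_cases hde : d = e <;> simp [hde, g.orth, g'.orth, Prod.ext_iff]
  smul a p hp e m := by
    by_cases hde : a ≤ e <;> simp [hde, g.smul a p hp, g'.smul a p hp, Prod.ext_iff]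

noncomputable def Gr.shift (g : Gr k σ M) (a : ℕ) : Gr k σ M where
  π d := if a ≤ d then g.π (d - a) else 0
  orth d e m := by
    by_cases h1 : a ≤ d <;> by_cases h2 : a ≤ e
    · by_cases h3 : d = e
      · simp [h2, h3, g.orth]
      · have : d - a ≠ e - a := by omega
        simp [h1, h2, h3, g.orth, this]
    · have : d ≠ e := by omega
      simp [h1, h2]
    · have : d ≠ e := by omega
      simp [h1, h2, this]
    · simp [h1, h2]
  smul b p hp e m := by
    by_cases h1 : a ≤ e <;> by_cases h2 : b ≤ e
    · by_cases h3 : b ≤ e - a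
      · have h4 : a ≤ e - b := by omega
        have h5 : e - a - b = e - b - a := by omega
        simp [h1, h2, h3, h4, g.smul b p hp, h5]
      · have h4 : ¬ a ≤ e - b := by omega
        simp [h1, h2, h3, h4, g.smul b p hp]
    · have h3 : ¬ b ≤ e - a := by omega
      simp [h1, h2, h3, g.smul b p hp]
    · have h4 : ¬ a ≤ e - b := by omega
      simp [h1, h2, h4]
    · simp [h1, h2]

lemma homComp_homog_mul (a : ℕ) (p : (MvPolynomial σ k)) (hp : p.IsHomogeneous a) (e : ℕ) (q : (MvPolynomial σ k)) :
    homogeneousComponent e (p * q) = if a ≤ e then p * homogeneousComponent (e - a) q else 0 := by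
  classical
  have hq : q = ∑ i ∈ Finset.range (q.totalDegree + 1 + e), homogeneousComponent i q := by
    conv_lhs => rw [← q.sum_homogeneousComponent]
    refine Finset.sum_subset (by intro x; simp; omega) ?_
    intro x _ hx
    apply homogeneousComponent_eq_zero
    simp at hx; omega
  have h1 : ∀ i, homogeneousComponent e (p * homogeneousComponent i q) =
      if i + a = e then p * homogeneousComponent i q else 0 := by
    intro i
    have hh : (p * homogeneousComponent i q).IsHomogeneous (a + i) :=
      hp.mul (homogeneousComponent_isHomogeneous i q)
    rw [homogeneousComponent_of_mem hh]
    simp [add_comm, eq_comm]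
  conv_lhs => rw [hq, Finset.mul_sum, map_sum]
  simp_rw [h1]
  by_cases hae : a ≤ e
  · have : ∀ i, (i + a = e) ↔ (i = e - a) := by intro i; omega
    simp_rw [this, if_pos hae]
    rw [Finset.sum_ite_eq']
    rw [if_pos]
    simp; omega
  · have : ∀ i, ¬ (i + a = e) := by intro i; omega
    simp [this, hae]

noncomputable def grR : Gr k σ (MvPolynomial σ k) where
  π d := (homogeneousComponent d).toAddMonoidHom
  orth d e m := by
    have := homogeneousComponent_of_mem (m := d) (homogeneousComponent_isHomogeneous e m)
    simpa using this
  smul a p hp e m := by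
    simpa using homComp_homog_mul a p hp e m

lemma grR_π (d : ℕ) (p : (MvPolynomial σ k)) : (grR : Gr k σ (MvPolynomial σ k)).π d p = homogeneousComponent d p := rfl

variable {ι κ : Type}

noncomputable def gpi (g : ι → Gr k σ M) : Gr k σ (ι → M) where
  π d :=
    { toFun := fun p i => (g i).π d (p i)
      map_zero' := by ext; simp
      map_add' := by intros; ext; simp }
  orth d e m := by
    ext i
    by_cases h : d = e <;> simp [h, (g i).orth]
  smul a p hp e m := by
    ext i
    by_cases h : a ≤ e <;> simp [h, (g i).smul a p hp]

/-- graded free module. -/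
noncomputable def free (deg : ι → ℕ) : Gr k σ (ι → (MvPolynomial σ k)) := gpi fun i => grR.shift (deg i)

lemma free_π (deg : ι → ℕ) (d : ℕ) (p : ι → (MvPolynomial σ k)) (i : ι) :
    (free deg : Gr k σ (ι → (MvPolynomial σ k))).π d p i
      = if deg i ≤ d then homogeneousComponent (d - deg i) (p i) else 0 := by
  change ((grR : Gr k σ (MvPolynomial σ k)).shift (deg i)).π d (p i) = _
  by_cases h : deg i ≤ d <;> simp [Gr.shift, h, grR_π]

lemma Gr.smul_hom (g : Gr k σ M) (d : ℕ) (m : M) (hm : g.π d m = m) (e : ℕ) (p : (MvPolynomial σ k)) :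
    g.π e (p • m) = if d ≤ e then homogeneousComponent (e - d) p • m else 0 := by
  classical
  have h0 : ∀ e', g.π e' m = if e' = d then m else 0 := by
    intro e'
    rw [← hm, g.orth, hm]
  have hp : p = ∑ i ∈ Finset.range (p.totalDegree + 1 + e), homogeneousComponent i p := by
    conv_lhs => rw [← p.sum_homogeneousComponent]
    refine Finset.sum_subset (by intro x; simp; omega) ?_
    intro x _ hx
    apply homogeneousComponent_eq_zero
    simp at hx; omega
  have h1 : ∀ i, g.π e (homogeneousComponent i p • m) =
      if i + d = e then homogeneousComponent i p • m else 0 := by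
    intro i
    rw [g.smul i _ (homogeneousComponent_isHomogeneous i p), h0]
    by_cases h : i + d = e
    · have h2 : i ≤ e := by omega
      have h3 : e - i = d := by omega
      simp [h, h2, h3]
    · by_cases h2 : i ≤ e
      · have h3 : e - i ≠ d := by omega
        simp [h, h3]
      · simp [h, h2]
  conv_lhs => rw [hp, Finset.sum_smul, map_sum]
  simp_rw [h1]
  by_cases hae : d ≤ e
  · have : ∀ i, (i + d = e) ↔ (i = e - d) := by intro i; omega
    simp_rw [this, if_pos hae]
    rw [Finset.sum_ite_eq']
    rw [if_pos]
    simp; omega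
  · have : ∀ i, ¬ (i + d = e) := by intro i; omega
    simp [this, hae]

lemma ghom_free [Fintype ι] [DecidableEq ι] (deg : ι → ℕ) (g : Gr k σ M) (f : (ι → (MvPolynomial σ k)) →ₗ[(MvPolynomial σ k)] M)
    (h : ∀ i, g.π (deg i) (f (Pi.single i 1)) = f (Pi.single i 1)) : GHom (free deg) g f := by
  intro d m
  rw [LinearMap.pi_apply_eq_sum_univ f, LinearMap.pi_apply_eq_sum_univ f m, map_sum]
  apply Finset.sum_congr rfl
  intro i _
  have e : (fun j => if i = j then (1 : (MvPolynomial σ k)) else 0) = Pi.single i 1 := by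
    ext j : 1
    simp [Pi.single_apply, eq_comm]
  rw [e, g.smul_hom _ _ (h i), free_π]
  split_ifs <;> simp

lemma free_π_single [DecidableEq ι] (deg : ι → ℕ) (i : ι) :
    (free deg : Gr k σ (ι → (MvPolynomial σ k))).π (deg i) (Pi.single i 1) = Pi.single i 1 := by
  ext j : 1
  rw [free_π]
  by_cases h : j = i
  · subst h
    simp only [le_refl, if_true, Nat.sub_self, Pi.single_eq_same]
    have := homogeneousComponent_of_mem (m := 0) (isHomogeneous_one σ k)
    simpa using this
  · simp [h]

lemma lift [Fintype ι] (deg : ι → ℕ) {g : Gr k σ B} {g' : Gr k σ C} {q : B →ₗ[(MvPolynomial σ k)] C}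
    (hq : GHom g g' q) (hs : Function.Surjective q) (f : (ι → (MvPolynomial σ k)) →ₗ[(MvPolynomial σ k)] C)
    (hf : GHom (free deg) g' f) :
    ∃ f' : (ι → (MvPolynomial σ k)) →ₗ[(MvPolynomial σ k)] B, GHom (free deg) g f' ∧ q ∘ₗ f' = f := by
  classical
  choose b hb using fun i => hs (f (Pi.single i 1))
  have hc : ∀ i, (Pi.basisFun (MvPolynomial σ k) ι).constr (MvPolynomial σ k) (fun i => g.π (deg i) (b i)) (Pi.single i 1)
      = g.π (deg i) (b i) := by
    intro i
    rw [← Pi.basisFun_apply, Module.Basis.constr_basis]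
  refine ⟨(Pi.basisFun (MvPolynomial σ k) ι).constr (MvPolynomial σ k) fun i => g.π (deg i) (b i), ?_, ?_⟩
  · apply ghom_free
    intro i
    rw [hc, g.orth, if_pos rfl]
  · refine (Pi.basisFun (MvPolynomial σ k) ι).ext fun i => ?_
    rw [Pi.basisFun_apply, LinearMap.comp_apply, hc, hq, hb, ← hf, free_π_single]

lemma factor {X K F : Type} [AddCommGroup X] [Module (MvPolynomial σ k) X] [AddCommGroup K] [Module (MvPolynomial σ k) K]
    [AddCommGroup F] [Module (MvPolynomial σ k) F] {gX : Gr k σ X} {gK : Gr k σ K} {gF : Gr k σ F}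
    {i : K →ₗ[(MvPolynomial σ k)] F} {f : F →ₗ[(MvPolynomial σ k)] M} (hi : Function.Injective i) (he : Function.Exact i f)
    (hiG : GHom gK gF i) (g : X →ₗ[(MvPolynomial σ k)] F) (hg : GHom gX gF g) (h0 : ∀ x, f (g x) = 0) :
    ∃ g' : X →ₗ[(MvPolynomial σ k)] K, GHom gX gK g' ∧ ∀ x, i (g' x) = g x := by
  have hr : ∀ x, g x ∈ LinearMap.range i := fun x => (he _).1 (h0 x)
  let e := LinearEquiv.ofInjective i hi
  have key : ∀ x, i ((e.symm.toLinearMap ∘ₗ g.codRestrict _ hr) x) = g x := by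
    intro x
    have : (e (e.symm (g.codRestrict _ hr x)) : F) = g x := by
      rw [LinearEquiv.apply_symm_apply]; rfl
    exact this
  refine ⟨e.symm.toLinearMap ∘ₗ g.codRestrict _ hr, ?_, key⟩
  intro d m
  apply hi
  rw [key, hiG, key, hg]

/-- regularity bound, truncated at `n` steps. -/
def HasRes (k σ : Type) [Field k] : ℕ → ∀ (M : Type) [AddCommGroup M] [Module (MvPolynomial σ k) M],
    Gr k σ M → ℕ → Prop
  | 0, _, _, _, _, _ => True
  | n + 1, M, _, _, g, r => ∃ (ι : Type) (_ : Fintype ι) (deg : ι → ℕ)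
      (f : (ι → MvPolynomial σ k) →ₗ[MvPolynomial σ k] M)
      (K : Type) (_ : AddCommGroup K) (_ : Module (MvPolynomial σ k) K) (gK : Gr k σ K)
      (i : K →ₗ[MvPolynomial σ k] (ι → MvPolynomial σ k)),
      (∀ j, deg j ≤ r) ∧ GHom (free deg) g f ∧ Function.Surjective f ∧
      GHom gK (free deg) i ∧ Function.Injective i ∧ Function.Exact i f ∧
      HasRes k σ n K gK (r + 1)

lemma HasRes.pred : ∀ {n : ℕ} {M : Type} [AddCommGroup M] [Module (MvPolynomial σ k) M] {g : Gr k σ M} {r : ℕ},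
    HasRes k σ (n + 1) M g r → HasRes k σ n M g r
  | 0, _, _, _, _, _, _ => trivial
  | n + 1, M, _, _, g, r, h => by
    obtain ⟨ι, _, deg, f, K, _, _, gK, i, h1, h2, h3, h4, h5, h6, h7⟩ := h
    exact ⟨ι, inferInstance, deg, f, K, inferInstance, inferInstance, gK, i, h1, h2, h3, h4, h5, h6, h7.pred⟩

lemma HasRes.mono : ∀ {n : ℕ} {M : Type} [AddCommGroup M] [Module (MvPolynomial σ k) M] {g : Gr k σ M} {r s : ℕ},
    r ≤ s → HasRes k σ n M g r → HasRes k σ n M g s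
  | 0, _, _, _, _, _, _, _, _ => trivial
  | n + 1, M, _, _, g, r, s, hrs, h => by
    obtain ⟨ι, _, deg, f, K, _, _, gK, i, h1, h2, h3, h4, h5, h6, h7⟩ := h
    exact ⟨ι, inferInstance, deg, f, K, inferInstance, inferInstance, gK, i, fun j => (h1 j).trans hrs, h2, h3, h4, h5, h6,
      h7.mono (by omega)⟩

lemma HasRes.of_subsingleton : ∀ {n : ℕ} {M : Type} [AddCommGroup M] [Module (MvPolynomial σ k) M] {g : Gr k σ M}
    {r : ℕ}, Subsingleton M → HasRes k σ n M g r
  | 0, _, _, _, _, _, _ => trivial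
  | n + 1, M, _, _, g, r, h => by
    refine ⟨Empty, inferInstance, fun _ => 0, 0, M, inferInstance, inferInstance, g, 0, fun j => j.elim, ?_, ?_, ?_, ?_, ?_,
      HasRes.of_subsingleton h⟩
    · intro d m; exact Subsingleton.elim _ _
    · intro m; exact ⟨0, Subsingleton.elim _ _⟩
    · intro d m; exact Subsingleton.elim _ _
    · intro x y _; exact Subsingleton.elim _ _
    · intro y; exact ⟨fun _ => ⟨0, Subsingleton.elim _ _⟩, fun _ => Subsingleton.elim _ _⟩

lemma HasRes.free [Fintype ι] (n : ℕ) (deg : ι → ℕ) (r : ℕ) (h : ∀ i, deg i ≤ r) :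
    HasRes k σ n (ι → (MvPolynomial σ k)) (free deg) r := by
  cases n with
  | zero => trivial
  | succ n =>
    refine ⟨ι, inferInstance, deg, LinearMap.id, PUnit, inferInstance, inferInstance,
      ⟨fun _ => 0, by intros; rfl, by intros; rfl⟩, 0, h, fun _ _ => rfl,
      Function.surjective_id, ?_, ?_, ?_, HasRes.of_subsingleton inferInstance⟩
    · intro d m; simp
    · intro x y _; rfl
    · intro y
      constructor
      · intro h; exact ⟨0, by simpa using Eq.symm h⟩
      · rintro ⟨x, rfl⟩; simp

lemma HasRes.shift : ∀ {n : ℕ} {M : Type} [AddCommGroup M] [Module (MvPolynomial σ k) M] {g : Gr k σ M} {r : ℕ}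
    (a : ℕ), HasRes k σ n M g r → HasRes k σ n M (g.shift a) (r + a)
  | 0, _, _, _, _, _, _, _ => trivial
  | n + 1, M, _, _, g, r, a, h => by
    obtain ⟨ι, _, deg, f, K, _, _, gK, i, h1, h2, h3, h4, h5, h6, h7⟩ := h
    have hfr : ∀ d (p : ι → (MvPolynomial σ k)), (PI.free (fun j => deg j + a) : Gr k σ (ι → (MvPolynomial σ k))).π d p
        = ((PI.free deg).shift a).π d p := by
      intro d p
      ext j : 1
      rw [free_π]
      by_cases had : a ≤ d
      · simp only [Gr.shift, had, if_true, free_π]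
        have : (deg j + a ≤ d) ↔ (deg j ≤ d - a) := by omega
        have h' : d - (deg j + a) = d - a - deg j := by omega
        simp only [this, h']
      · have : ¬ (deg j + a ≤ d) := by omega
        simp [Gr.shift, had, this]
    refine ⟨ι, inferInstance, fun j => deg j + a, f, K, inferInstance, inferInstance, gK.shift a, i, fun j => by
      have := h1 j; dsimp only; omega, ?_, h3, ?_, h5, h6, ?_⟩
    · intro d m
      rw [hfr]
      by_cases had : a ≤ d
      · simp [Gr.shift, had, h2 _ _]
      · simp [Gr.shift, had]
    · intro d m
      rw [hfr]
      by_cases had : a ≤ d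
      · simp [Gr.shift, had, h4 _ _]
      · simp [Gr.shift, had]
    · have := h7.shift a
      rwa [show r + 1 + a = r + a + 1 by omega] at this

end Graded
end PI

namespace PI

section Seq
variable {k σ : Type} [Field k]

lemma HasRes.ext : ∀ {n : ℕ} {A B C : Type} [AddCommGroup A] [Module (MvPolynomial σ k) A]
    [AddCommGroup B] [Module (MvPolynomial σ k) B] [AddCommGroup C] [Module (MvPolynomial σ k) C]
    {gA : Gr k σ A} {gB : Gr k σ B} {gC : Gr k σ C} {u : A →ₗ[MvPolynomial σ k] B}
    {q : B →ₗ[MvPolynomial σ k] C} {r : ℕ},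
    GHom gA gB u → GHom gB gC q → Function.Injective u → Function.Exact u q →
    Function.Surjective q → HasRes k σ n A gA r → HasRes k σ n C gC r → HasRes k σ n B gB r
  | 0, _, _, _, _, _, _, _, _, _, _, _, _, _, _, _, _, _, _, _, _, _, _ => trivial
  | n + 1, A, B, C, _, _, _, _, _, _, gA, gB, gC, u, q, r, hu, hq, hui, hex, hqs, hA, hC => by
    obtain ⟨ι, _, degA, α, KA, _, _, gKA, iA, a1, a2, a3, a4, a5, a6, a7⟩ := hA
    obtain ⟨κ, _, degC, γ, KC, _, _, gKC, iC, c1, c2, c3, c4, c5, c6, c7⟩ := hC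
    obtain ⟨γ', hγ', hqγ⟩ := lift degC hq hqs γ c2
    let deg : ι ⊕ κ → ℕ := Sum.elim degA degC
    let p1 : (ι ⊕ κ → MvPolynomial σ k) →ₗ[MvPolynomial σ k] (ι → MvPolynomial σ k) :=
      LinearMap.funLeft _ _ Sum.inl
    let p2 : (ι ⊕ κ → MvPolynomial σ k) →ₗ[MvPolynomial σ k] (κ → MvPolynomial σ k) :=
      LinearMap.funLeft _ _ Sum.inr
    have hp1 : GHom (PI.free deg) (PI.free degA) p1 := by
      intro d m
      ext i : 1
      change (PI.free deg).π d m (Sum.inl i) = _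
      rw [free_π, free_π]
      rfl
    have hp2 : GHom (PI.free deg) (PI.free degC) p2 := by
      intro d m
      ext i : 1
      change (PI.free deg).π d m (Sum.inr i) = _
      rw [free_π, free_π]
      rfl
    let j1 : (ι → MvPolynomial σ k) →ₗ[MvPolynomial σ k] (ι ⊕ κ → MvPolynomial σ k) :=
      { toFun := fun x => Sum.elim x 0
        map_add' := by intro x y; ext i : 1; cases i <;> simp
        map_smul' := by intro c x; ext i : 1; cases i <;> simp }
    have hj1 : GHom (PI.free degA) (PI.free deg) j1 := by
      intro d m
      ext i : 1
      rw [free_π]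
      cases i with
      | inl i =>
        change (PI.free degA).π d m i = _
        rw [free_π]; rfl
      | inr i =>
        change 0 = if _ then (homogeneousComponent _) (0 : MvPolynomial σ k) else 0
        simp
    have p1j1 : ∀ x, p1 (j1 x) = x := fun x => rfl
    have p2j1 : ∀ x, p2 (j1 x) = 0 := fun x => rfl
    have hj1p : ∀ x, p2 x = 0 → x = j1 (p1 x) := by
      intro x hx
      ext i : 1
      cases i with
      | inl i => rfl
      | inr i => exact congrFun hx i
    let f : (ι ⊕ κ → MvPolynomial σ k) →ₗ[MvPolynomial σ k] B := u ∘ₗ α ∘ₗ p1 + γ' ∘ₗ p2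
    have hfa : ∀ x, f x = u (α (p1 x)) + γ' (p2 x) := fun x => rfl
    have hqu : ∀ x, q (u x) = 0 := fun x => (hex _).2 ⟨x, rfl⟩
    have hqγ' : ∀ x, q (γ' x) = γ x := fun x => by rw [← hqγ]; rfl
    have hf : GHom (PI.free deg) gB f := by
      intro d m
      rw [hfa, hfa, map_add, hp1, hp2, a2, hu, hγ']
    have hfs : Function.Surjective f := by
      intro b
      obtain ⟨y, hy⟩ := c3 (q b)
      have : q (b - γ' y) = 0 := by rw [map_sub, hqγ', hy, sub_self]
      obtain ⟨a, ha⟩ := (hex _).1 this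
      obtain ⟨x, hx⟩ := a3 a
      refine ⟨Sum.elim x y, ?_⟩
      rw [hfa]
      change u (α x) + γ' y = b
      rw [hx, ha, sub_add_cancel]
    have hKi := Gr.sub_subtype (PI.free deg) (LinearMap.ker f) (ker_stable hf)
    have hKe : Function.Exact (LinearMap.ker f).subtype f := by
      intro y
      simp
    obtain ⟨v, hv, hv'⟩ := factor (Submodule.injective_subtype (LinearMap.ker f)) hKe hKi
      (j1 ∘ₗ iA) (hj1.comp a4) (by
        intro x
        have : α (iA x) = 0 := (a6 _).2 ⟨x, rfl⟩
        rw [hfa, LinearMap.comp_apply, p1j1, p2j1, this, map_zero, map_zero, add_zero])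
    obtain ⟨w, hw, hw'⟩ := factor c5 c6 c4 (p2 ∘ₗ (LinearMap.ker f).subtype) (hp2.comp hKi) (by
        intro x
        have h0 : f x = 0 := x.2
        have h1 : q (f x) = 0 := by rw [h0, map_zero]
        rw [hfa, map_add, hqu, hqγ', zero_add] at h1
        exact h1)
    refine ⟨ι ⊕ κ, inferInstance, deg, f, LinearMap.ker f, inferInstance, inferInstance,
      _, (LinearMap.ker f).subtype, ?_, hf, hfs, hKi, Submodule.injective_subtype _, hKe, ?_⟩
    · rintro (i | i)
      · exact a1 i
      · exact c1 i
    · refine HasRes.ext hv hw ?_ ?_ ?_ a7 c7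
      · intro x y hxy
        apply a5
        have := congrArg p1 ((hv' x).symm.trans ((congrArg _ hxy).trans (hv' y)))
        exact this
      · intro y
        constructor
        · intro hy
          have h2 : p2 (y : _) = 0 := by
            have := hw' y
            rw [hy, map_zero] at this
            exact this.symm
          have h3 : f y = 0 := y.2
          rw [hfa, h2, map_zero, add_zero] at h3
          have h4 : α (p1 y) = 0 := hui (by rw [h3, map_zero])
          obtain ⟨x, hx⟩ := (a6 _).1 h4
          refine ⟨x, ?_⟩
          apply Submodule.injective_subtype
          rw [hv', LinearMap.comp_apply, hx]
          exact (hj1p _ h2).symm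
        · rintro ⟨x, rfl⟩
          apply c5
          rw [hw', map_zero, LinearMap.comp_apply, hv', LinearMap.comp_apply, p2j1]
      · intro z
        have h1 : q (γ' (iC z)) = 0 := by rw [hqγ']; exact (c6 _).2 ⟨z, rfl⟩
        obtain ⟨a, ha⟩ := (hex _).1 h1
        obtain ⟨x, hx⟩ := a3 (-a)
        have hmem : Sum.elim x (iC z) ∈ LinearMap.ker f := by
          rw [LinearMap.mem_ker, hfa]
          change u (α x) + γ' (iC z) = 0
          rw [hx, map_neg, ha, neg_add_cancel]
        refine ⟨⟨_, hmem⟩, ?_⟩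
        apply c5
        rw [hw']
        rfl

lemma HasRes.coker : ∀ {n : ℕ} {A B C : Type} [AddCommGroup A] [Module (MvPolynomial σ k) A]
    [AddCommGroup B] [Module (MvPolynomial σ k) B] [AddCommGroup C] [Module (MvPolynomial σ k) C]
    {gA : Gr k σ A} {gB : Gr k σ B} {gC : Gr k σ C} {u : A →ₗ[MvPolynomial σ k] B}
    {q : B →ₗ[MvPolynomial σ k] C} {r : ℕ},
    GHom gA gB u → GHom gB gC q → Function.Injective u → Function.Exact u q →
    Function.Surjective q → HasRes k σ n A gA (r + 1) → HasRes k σ n B gB r → HasRes k σ n C gC r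
  | 0, _, _, _, _, _, _, _, _, _, _, _, _, _, _, _, _, _, _, _, _, _, _ => trivial
  | n + 1, A, B, C, _, _, _, _, _, _, gA, gB, gC, u, q, r, hu, hq, hui, hex, hqs, hA, hB => by
    obtain ⟨ι, _, deg, β, K, _, _, gK, i, b1, b2, b3, b4, b5, b6, b7⟩ := hB
    have hf : GHom (PI.free deg) gC (q ∘ₗ β) := hq.comp b2
    have hKi := Gr.sub_subtype (PI.free deg) (LinearMap.ker (q ∘ₗ β)) (ker_stable hf)
    have hKe : Function.Exact (LinearMap.ker (q ∘ₗ β)).subtype (q ∘ₗ β) := by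
      intro y
      simp
    obtain ⟨v, hv, hv'⟩ := factor (Submodule.injective_subtype (LinearMap.ker (q ∘ₗ β))) hKe hKi
      i b4 (by
        intro x
        have : β (i x) = 0 := (b6 _).2 ⟨x, rfl⟩
        rw [LinearMap.comp_apply, this, map_zero])
    obtain ⟨w, hw, hw'⟩ := factor hui hex hu (β ∘ₗ (LinearMap.ker (q ∘ₗ β)).subtype)
      (b2.comp hKi) (fun x => x.2)
    refine ⟨ι, inferInstance, deg, q ∘ₗ β, LinearMap.ker (q ∘ₗ β), inferInstance, inferInstance,
      _, (LinearMap.ker (q ∘ₗ β)).subtype, b1, hf, hqs.comp b3, hKi,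
      Submodule.injective_subtype _, hKe, ?_⟩
    refine HasRes.ext hv hw ?_ ?_ ?_ b7 hA.pred
    · intro x y hxy
      apply b5
      exact ((hv' x).symm.trans ((congrArg _ hxy).trans (hv' y)))
    · intro y
      constructor
      · intro hy
        have h1 := hw' y
        rw [hy, map_zero] at h1
        obtain ⟨x, hx⟩ := (b6 _).1 h1.symm
        exact ⟨x, Submodule.injective_subtype _ (by rw [hv', hx])⟩
      · rintro ⟨x, rfl⟩
        apply hui
        rw [hw', map_zero, LinearMap.comp_apply, hv']
        exact (b6 _).2 ⟨x, rfl⟩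
    · intro a
      obtain ⟨x, hx⟩ := b3 (u a)
      have hmem : x ∈ LinearMap.ker (q ∘ₗ β) := by
        rw [LinearMap.mem_ker, LinearMap.comp_apply, hx]
        exact (hex _).2 ⟨a, rfl⟩
      refine ⟨⟨x, hmem⟩, hui ?_⟩
      rw [hw']
      exact hx

variable {M N : Type} [AddCommGroup M] [Module (MvPolynomial σ k) M] [AddCommGroup N]
  [Module (MvPolynomial σ k) N]

lemma HasRes.prod {n r : ℕ} {g : Gr k σ M} {g' : Gr k σ N} (h : HasRes k σ n M g r)
    (h' : HasRes k σ n N g' r) : HasRes k σ n (M × N) (g.prod g') r := by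
  refine HasRes.ext (u := LinearMap.inl _ M N) (q := LinearMap.snd _ M N) ?_ ?_ ?_ ?_ ?_ h h'
  · intro d m
    simp [Gr.prod]
  · intro d m
    simp [Gr.prod]
  · exact LinearMap.inl_injective
  · exact Function.Exact.inl_snd
  · exact LinearMap.snd_surjective

lemma HasRes.iso {n r : ℕ} {g : Gr k σ M} {g' : Gr k σ N} (f : M →ₗ[MvPolynomial σ k] N)
    (hf : GHom g g' f) (hb : Function.Bijective f) (h : HasRes k σ n M g r) :
    HasRes k σ n N g' r := by
  cases n with
  | zero => trivial
  | succ n =>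
    obtain ⟨ι, _, deg, β, K, _, _, gK, i, b1, b2, b3, b4, b5, b6, b7⟩ := h
    refine ⟨ι, inferInstance, deg, f ∘ₗ β, K, inferInstance, inferInstance, gK, i, b1,
      hf.comp b2, hb.2.comp b3, b4, b5, ?_, b7⟩
    intro y
    rw [← b6 y, LinearMap.comp_apply]
    exact ⟨fun h => hb.1 (by rw [h, map_zero]), fun h => by rw [h, map_zero]⟩

/-- Comparison with a minimal cover. -/
lemma HasRes.min_step {ι : Type} [Fintype ι] {n r : ℕ} {g : Gr k σ M} (h : HasRes k σ (n + 1) M g r)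
    (deg : ι → ℕ) (p : (ι → MvPolynomial σ k) →ₗ[MvPolynomial σ k] M) (hp : GHom (PI.free deg) g p)
    (hps : Function.Surjective p) (gN : Gr k σ N) (j : N →ₗ[MvPolynomial σ k] (ι → MvPolynomial σ k))
    (hj : GHom gN (PI.free deg) j) (hji : Function.Injective j) (hje : Function.Exact j p)
    (hmin : ∀ z l, constantCoeff (j z l) = 0) :
    (∀ l, deg l ≤ r) ∧ HasRes k σ n N gN (r + 1) := by
  classical
  obtain ⟨κ, _, degF, f, K, _, _, gK, i, b1, b2, b3, b4, b5, b6, b7⟩ := h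
  obtain ⟨φ, hφ, hφf⟩ := lift degF hp hps f b2
  have hφf' : ∀ x, p (φ x) = f x := fun x => by rw [← hφf]; rfl
  -- Nakayama
  have hbas : ∀ d l, deg l = d → Pi.single l 1 ∈ LinearMap.range φ := by
    intro d
    induction d using Nat.strong_induction_on with
    | _ d ih =>
      intro l hl
      obtain ⟨y, hy⟩ := b3 (p (Pi.single l 1))
      have h0 : p (Pi.single l 1 - φ y) = 0 := by rw [map_sub, hφf', hy, sub_self]
      obtain ⟨z, hz⟩ := (hje _).1 h0
      have h1 : Pi.single l 1 = φ ((PI.free degF).π d y) + (PI.free deg).π d (j z) := by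
        rw [hφ, hz, map_sub, add_sub_cancel, ← hl, free_π_single]
      rw [h1]
      refine Submodule.add_mem _ ⟨_, rfl⟩ ?_
      rw [pi_eq_sum_univ ((PI.free deg).π d (j z))]
      refine Submodule.sum_mem _ fun s _ => ?_
      have e : (fun j => if s = j then (1 : MvPolynomial σ k) else 0) = Pi.single s 1 := by
        ext j : 1
        simp [Pi.single_apply, eq_comm]
      rw [e, free_π]
      by_cases hs : deg s < d
      · exact Submodule.smul_mem _ _ (ih _ hs s rfl)
      · by_cases hs' : deg s ≤ d
        · have : d - deg s = 0 := by omega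
          rw [if_pos hs', this, homogeneousComponent_zero, ← constantCoeff_eq, hmin, C_0, zero_smul]
          exact Submodule.zero_mem _
        · rw [if_neg hs', zero_smul]
          exact Submodule.zero_mem _
  have hφs : Function.Surjective φ := by
    intro x
    have : x ∈ LinearMap.range φ := by
      rw [pi_eq_sum_univ x]
      refine Submodule.sum_mem _ fun s _ => Submodule.smul_mem _ _ ?_
      have e : (fun j => if s = j then (1 : MvPolynomial σ k) else 0) = Pi.single s 1 := by
        ext j : 1
        simp [Pi.single_apply, eq_comm]
      rw [e]
      exact hbas _ s rfl
    exact this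
  have hdeg : ∀ l, deg l ≤ r := by
    intro l
    by_contra hl
    obtain ⟨y, hy⟩ := hφs (Pi.single l 1)
    have h1 : φ y l = 0 := by
      rw [LinearMap.pi_apply_eq_sum_univ φ, Finset.sum_apply]
      refine Finset.sum_eq_zero fun s _ => ?_
      have e : (fun j => if s = j then (1 : MvPolynomial σ k) else 0) = Pi.single s 1 := by
        ext j : 1
        simp [Pi.single_apply, eq_comm]
      rw [e, ← free_π_single degF s, hφ, Pi.smul_apply, free_π, if_neg, smul_zero]
      have := b1 s
      omega
    rw [hy] at h1
    simp at h1
  refine ⟨hdeg, ?_⟩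
  -- splitting
  obtain ⟨s, hs, hsφ⟩ := lift deg hφ hφs LinearMap.id (fun _ _ => rfl)
  have hsφ' : ∀ x, φ (s x) = x := fun x => by
    rw [← LinearMap.comp_apply, hsφ]; rfl
  have hQi := Gr.sub_subtype (PI.free degF) (LinearMap.ker φ) (ker_stable hφ)
  have hQe : Function.Exact (LinearMap.ker φ).subtype φ := by
    intro y
    simp
  have hQinj := Submodule.injective_subtype (LinearMap.ker φ)
  -- the kernel of `φ` has a resolution
  obtain ⟨ρ, hρ, hρ'⟩ := factor hQinj hQe hQi (LinearMap.id - s ∘ₗ φ)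
    (gX := PI.free degF) (by
      intro d m
      simp only [LinearMap.sub_apply, LinearMap.id_apply, LinearMap.comp_apply, map_sub]
      rw [hφ, hs]) (by
      intro x
      simp only [LinearMap.sub_apply, LinearMap.id_apply, LinearMap.comp_apply, map_sub]
      rw [hsφ', sub_self])
  have hQ : ∀ n, HasRes k σ n (LinearMap.ker φ) ((PI.free degF).sub (LinearMap.ker φ)
      (ker_stable hφ)) r := by
    intro n
    refine HasRes.coker (u := s) (q := ρ) hs hρ ?_ ?_ ?_ (HasRes.free n deg (r + 1)
      (fun l => (hdeg l).trans (Nat.le_succ r))) (HasRes.free n degF r b1)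
    · intro x y hxy
      rw [← hsφ' x, hxy, hsφ']
    · intro y
      constructor
      · intro hy
        have := hρ' y
        rw [hy, map_zero] at this
        exact ⟨φ y, (sub_eq_zero.1 this.symm).symm⟩
      · rintro ⟨x, rfl⟩
        apply hQinj
        rw [hρ', map_zero]
        simp [hsφ']
    · intro z
      refine ⟨z, hQinj ?_⟩
      rw [hρ']
      have : φ z = 0 := z.2
      simp [this]
  -- Q → K → N
  obtain ⟨v, hv, hv'⟩ := factor b5 b6 b4 (LinearMap.ker φ).subtype hQi (by
    intro x
    have : φ x = 0 := x.2
    rw [← hφf']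
    change p (φ x) = 0
    rw [this, map_zero])
  obtain ⟨w, hw, hw'⟩ := factor hji hje hj (φ ∘ₗ i) (hφ.comp b4) (by
    intro x
    rw [LinearMap.comp_apply, hφf']
    exact (b6 _).2 ⟨x, rfl⟩)
  refine HasRes.coker (u := v) (q := w) hv hw ?_ ?_ ?_ ((hQ n).mono (by omega)) b7
  · intro x y hxy
    apply hQinj
    rw [← hv', hxy, hv']
  · intro y
    constructor
    · intro hy
      have := hw' y
      rw [hy, map_zero] at this
      exact ⟨⟨i y, this.symm⟩, b5 (hv' _)⟩
    · rintro ⟨x, rfl⟩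
      apply hji
      rw [hw', map_zero, LinearMap.comp_apply, hv']
      exact x.2
  · intro z
    obtain ⟨x, hx⟩ := hφs (j z)
    have : f x = 0 := by rw [← hφf', hx]; exact (hje _).2 ⟨z, rfl⟩
    obtain ⟨y, rfl⟩ := (b6 _).1 this
    exact ⟨y, hji (by rw [hw']; exact hx)⟩

end Seq
end PI

namespace PI

section Ideals
variable {k σ : Type} [Field k]

/-- The ideal generated by the squarefree monomials of a family of finite sets. -/
noncomputable def sqI (k : Type) [Field k] (E : Set (Finset σ)) : Ideal (MvPolynomial σ k) :=
  Ideal.span ((fun e => ∏ u ∈ e, X u) '' E)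

lemma mem_sqI (E : Set (Finset σ)) (p : MvPolynomial σ k) :
    p ∈ sqI k E ↔ ∀ m ∈ p.support, ∃ e ∈ E, ∀ u ∈ e, m u ≠ 0 := by
  classical
  have h1 : sqI k E = Ideal.span ((fun s => monomial s (1 : k)) ''
      ((fun e : Finset σ => ∑ u ∈ e, Finsupp.single u 1) '' E)) := by
    rw [Set.image_image, sqI]
    congr 2
    ext e : 1
    rw [monomial_sum_one]
    rfl
  rw [h1, mem_ideal_span_monomial_image]
  refine forall₂_congr fun m _ => ?_
  rw [Set.exists_mem_image]
  refine exists_congr fun e => and_congr_right fun _ => ?_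
  have h2 : ∀ v, (∑ u ∈ e, Finsupp.single u 1 : σ →₀ ℕ) v = if v ∈ e then 1 else 0 := by
    intro v
    rw [Finsupp.finsetSum_apply]
    simp [Finsupp.single_apply]
  rw [Finsupp.le_def]
  simp_rw [h2]
  constructor
  · intro h u hu
    have := h u
    rw [if_pos hu] at this
    omega
  · intro h u
    split_ifs with hu
    · have := h u hu
      omega
    · omega

lemma sqI_stable (E : Set (Finset σ)) : ∀ d, ∀ p ∈ sqI k E, (grR : Gr k σ _).π d p ∈ sqI k E := by
  classical
  intro d p hp
  rw [mem_sqI] at *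
  intro m hm
  apply hp m
  rw [grR_π, mem_support_iff, coeff_homogeneousComponent] at hm
  rw [mem_support_iff]
  intro h
  apply hm
  simp [h]

/-- The grading on the ideal. -/
noncomputable def gI (k : Type) [Field k] (E : Set (Finset σ)) : Gr k σ (sqI k E) :=
  grR.sub (sqI k E) (sqI_stable E)

def RegI (k : Type) [Field k] (E : Set (Finset σ)) (r : ℕ) : Prop :=
  ∀ n, HasRes k σ n (sqI k E) (gI k E) r

lemma RegI.mono {E : Set (Finset σ)} {r s : ℕ} (h : RegI k E r) (hrs : r ≤ s) : RegI k E s :=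
  fun n => (h n).mono hrs

lemma RegI.of_empty_mem {E : Set (Finset σ)} (h : ∅ ∈ E) (r : ℕ) : RegI k E r := by
  have hall : ∀ p : MvPolynomial σ k, p ∈ sqI k E := by
    intro p
    rw [mem_sqI]
    intro m _
    exact ⟨∅, h, by simp⟩
  intro n
  refine HasRes.iso (g := PI.free (fun _ : Unit => 0))
    ((LinearMap.proj ()).codRestrict (sqI k E) (fun c => hall _)) ?_ ?_
    (HasRes.free n _ r (by simp))
  · intro d m
    apply Subtype.ext
    change (PI.free (fun _ : Unit => 0)).π d m () = homogeneousComponent d (m ())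
    rw [free_π]
    simp
  · constructor
    · intro x y hxy
      ext i : 1
      exact congrArg Subtype.val hxy
    · intro p
      exact ⟨fun _ => p, rfl⟩

lemma RegI.of_empty (r : ℕ) : RegI k (∅ : Set (Finset σ)) r := by
  intro n
  apply HasRes.of_subsingleton
  have : sqI k (∅ : Set (Finset σ)) = ⊥ := by simp [sqI]
  rw [this]
  infer_instance

variable [DecidableEq σ]

def del (x : σ) (E : Set (Finset σ)) : Set (Finset σ) := {e | e ∈ E ∧ x ∉ e}
def con (x : σ) (E : Set (Finset σ)) : Set (Finset σ) := (fun e => e.erase x) '' E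

lemma RegI.branch {E : Set (Finset σ)} (x : σ) {r s : ℕ} (hd : RegI k (del x E) r)
    (hc : RegI k (con x E) s) (hsr : s + 1 ≤ r) : RegI k E r := by
  have hdc : sqI k (del x E) ≤ sqI k (con x E) := by
    intro p hp
    rw [mem_sqI] at *
    intro m hm
    obtain ⟨e, he, h⟩ := hp m hm
    exact ⟨e.erase x, ⟨e, he.1, rfl⟩, fun u hu => h u (Finset.mem_of_mem_erase hu)⟩
  have hdE : sqI k (del x E) ≤ sqI k E := by
    intro p hp
    rw [mem_sqI] at *
    intro m hm
    obtain ⟨e, he, h⟩ := hp m hm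
    exact ⟨e, he.1, h⟩
  have hsupp : ∀ (p : MvPolynomial σ k) m, m ∈ ((X x : MvPolynomial σ k) • p).support →
      m x ≠ 0 ∧ m - Finsupp.single x 1 ∈ p.support := by
    intro p m hm
    rw [smul_eq_mul, mem_support_iff, coeff_X_mul'] at hm
    split_ifs at hm with h
    · exact ⟨by simpa using h, by simpa using hm⟩
    · exact absurd rfl hm
  have hxc : ∀ p : sqI k (con x E), ((X x : MvPolynomial σ k) • (sqI k (con x E)).subtype) p
      ∈ sqI k E := by
    rintro ⟨p, hp⟩
    change (X x : MvPolynomial σ k) • p ∈ _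
    rw [mem_sqI] at *
    intro m hm
    obtain ⟨h1, h2⟩ := hsupp p m hm
    obtain ⟨_, ⟨e, he, rfl⟩, h⟩ := hp _ h2
    refine ⟨e, he, fun u hu => ?_⟩
    by_cases hux : u = x
    · rwa [hux]
    · have := h u (Finset.mem_erase.2 ⟨hux, hu⟩)
      simp at this
      omega
  have hnzd : ∀ p : MvPolynomial σ k, (X x : MvPolynomial σ k) • p ∈ sqI k (del x E) → p ∈ sqI k (del x E) := by
    intro p hp
    rw [mem_sqI] at *
    intro m hm
    obtain ⟨e, he, h⟩ := hp (m + Finsupp.single x 1) (by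
      rw [mem_support_iff] at *
      rw [smul_eq_mul, mul_comm, coeff_mul_X]
      exact hm)
    refine ⟨e, he, fun u hu => ?_⟩
    have hux : u ≠ x := fun h => he.2 (h ▸ hu)
    have := h u hu
    simpa [Finsupp.single_apply, hux.symm] using this
  let u : sqI k (del x E) →ₗ[MvPolynomial σ k] sqI k (del x E) × sqI k (con x E) :=
    LinearMap.prod ((X x : MvPolynomial σ k) • LinearMap.id) (-(Submodule.inclusion hdc))
  let q : sqI k (del x E) × sqI k (con x E) →ₗ[MvPolynomial σ k] sqI k E :=
    LinearMap.coprod (Submodule.inclusion hdE)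
      (((X x : MvPolynomial σ k) • (sqI k (con x E)).subtype).codRestrict (sqI k E) hxc)
  have hu : ∀ a, u a = ((X x : MvPolynomial σ k) • a, -(Submodule.inclusion hdc a)) := fun a => rfl
  have hq : ∀ a, ((q a : sqI k E) : MvPolynomial σ k) = (a.1 : MvPolynomial σ k) + X x * (a.2 : MvPolynomial σ k) := fun a => rfl
  have hX : ∀ d (p : MvPolynomial σ k), (grR : Gr k σ _).π d (X x * p) =
      X x * ((grR : Gr k σ _).shift 1).π d p := by
    intro d p
    have := (grR : Gr k σ _).smul 1 (X x) (isHomogeneous_X k x) d p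
    rw [smul_eq_mul] at this
    rw [this]
    by_cases h : 1 ≤ d <;> simp [Gr.shift, h]
  have hsh : ∀ (E' : Set (Finset σ)) d (p : sqI k E'), ((((gI k E').shift 1).π d p : sqI k E') :
      MvPolynomial σ k) = ((grR : Gr k σ _).shift 1).π d p := by
    intro E' d p
    by_cases h : 1 ≤ d
    · simp only [Gr.shift, h, if_true]
      rfl
    · simp [Gr.shift, h]
  intro n
  refine HasRes.coker (gA := (gI k (del x E)).shift 1)
    (gB := (gI k (del x E)).prod ((gI k (con x E)).shift 1)) (u := u) (q := q) ?_ ?_ ?_ ?_ ?_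
    ((hd n).shift 1) ((hd n).prod (((hc n).shift 1).mono hsr))
  · intro d m
    rw [hu, hu]
    refine Prod.ext ?_ ?_
    · apply Subtype.ext
      change (X x : MvPolynomial σ k) * (((((gI k (del x E)).shift 1).π d m : sqI k _)) : MvPolynomial σ k)
        = (grR : Gr k σ _).π d (X x * m.1)
      rw [hX, hsh]
    · change -(Submodule.inclusion hdc (((gI k (del x E)).shift 1).π d m)) =
        ((gI k (con x E)).shift 1).π d (-(Submodule.inclusion hdc m))
      rw [map_neg]
      congr 1
      apply Subtype.ext
      rw [hsh]
      exact hsh (del x E) d m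
  · intro d m
    apply Subtype.ext
    change (grR : Gr k σ _).π d (m.1 : MvPolynomial σ k) + X x *
      (((((gI k (con x E)).shift 1).π d m.2 : sqI k _)) : MvPolynomial σ k) =
      (grR : Gr k σ _).π d ((m.1 : MvPolynomial σ k) + X x * (m.2 : MvPolynomial σ k))
    rw [map_add, hX, hsh]
  · intro a b hab
    rw [hu, hu, Prod.mk.injEq] at hab
    exact Submodule.inclusion_injective hdc (neg_injective hab.2)
  · rintro ⟨a, b⟩
    constructor
    · intro h
      have h1 : (a : MvPolynomial σ k) + X x * (b : MvPolynomial σ k) = 0 := by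
        rw [← hq (a, b), h]; rfl
      have h2 : (a : MvPolynomial σ k) = (X x : MvPolynomial σ k) • (-b : MvPolynomial σ k) := by
        rw [smul_eq_mul, mul_neg]; exact eq_neg_of_add_eq_zero_left h1
      have h3 : (-b : MvPolynomial σ k) ∈ sqI k (del x E) := hnzd _ (h2 ▸ a.2)
      refine ⟨⟨_, h3⟩, ?_⟩
      rw [hu]
      refine Prod.ext ?_ ?_
      · exact Subtype.ext h2.symm
      · apply Subtype.ext
        change -(-(b : MvPolynomial σ k)) = b
        simp
    · rintro ⟨c, hc⟩
      apply Subtype.ext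
      rw [hq, ← hc, hu]
      change (X x : MvPolynomial σ k) * (c : MvPolynomial σ k) + X x * (-(c : MvPolynomial σ k)) = 0
      ring
  · rintro ⟨p, hp⟩
    have hspan : p ∈ sqI k (del x E) ⊔ Ideal.span {X x} * sqI k (con x E) := by
      refine (Ideal.span_le.2 ?_ : sqI k E ≤ _) hp
      rintro _ ⟨e, he, rfl⟩
      by_cases hx : x ∈ e
      · apply Ideal.mem_sup_right
        simp only
        rw [← Finset.mul_prod_erase e _ hx]
        exact Ideal.mul_mem_mul (Ideal.mem_span_singleton_self _)
          (Ideal.subset_span ⟨_, ⟨e, he, rfl⟩, rfl⟩)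
      · apply Ideal.mem_sup_left
        exact Ideal.subset_span ⟨e, ⟨he, hx⟩, rfl⟩
    obtain ⟨a, ha, c, hc, hac⟩ := Submodule.mem_sup.1 hspan
    obtain ⟨b, hb, rfl⟩ := Ideal.mem_span_singleton_mul.1 hc
    exact ⟨(⟨a, ha⟩, ⟨b, hb⟩), Subtype.ext (by rw [hq]; exact hac)⟩

lemma RegI.of_gens {ι : Type} : ∀ (N : ℕ) (E : Set (Finset σ)) (T : Finset ι) (ρ : ι → Finset σ),
    ∑ i ∈ T, (ρ i).card ≤ N → (∀ i ∈ T, ρ i ∈ E) → (∀ e ∈ E, ∃ i ∈ T, ρ i ⊆ e) →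
    RegI k E (1 + ∑ i ∈ T, ((ρ i).card - 1)) := by
  intro N
  induction N with
  | zero =>
    intro E T ρ hN h1 h2
    rcases E.eq_empty_or_nonempty with rfl | ⟨e, he⟩
    · exact RegI.of_empty _
    · obtain ⟨i, hi, _⟩ := h2 e he
      have : (ρ i).card = 0 := by
        have := Finset.single_le_sum (f := fun i => (ρ i).card) (fun _ _ => Nat.zero_le _) hi
        omega
      rw [Finset.card_eq_zero] at this
      exact RegI.of_empty_mem (this ▸ h1 i hi) _
  | succ N ih =>
    intro E T ρ hN h1 h2
    rcases E.eq_empty_or_nonempty with rfl | ⟨e, he⟩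
    · exact RegI.of_empty _
    obtain ⟨i, hi, _⟩ := h2 e he
    rcases (ρ i).eq_empty_or_nonempty with h0 | ⟨x, hx⟩
    · exact RegI.of_empty_mem (h0 ▸ h1 i hi) _
    have hpos : 0 < (ρ i).card := Finset.card_pos.2 ⟨x, hx⟩
    have hlt : ∑ j ∈ T with x ∉ ρ j, (ρ j).card < ∑ j ∈ T, (ρ j).card := by
      refine Finset.sum_lt_sum_of_subset (Finset.filter_subset _ _) hi (by simp [hx]) hpos ?_
      intros; exact Nat.zero_le _
    have hd : RegI k (del x E) (1 + ∑ j ∈ T with x ∉ ρ j, ((ρ j).card - 1)) := by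
      apply ih
      · omega
      · intro j hj
        rw [Finset.mem_filter] at hj
        exact ⟨h1 j hj.1, hj.2⟩
      · rintro e ⟨he, hxe⟩
        obtain ⟨j, hj, hje⟩ := h2 e he
        exact ⟨j, Finset.mem_filter.2 ⟨hj, fun h => hxe (hje h)⟩, hje⟩
    have hd' : RegI k (del x E) (1 + ∑ j ∈ T, ((ρ j).card - 1)) :=
      hd.mono (Nat.add_le_add_left (Finset.sum_le_sum_of_subset (Finset.filter_subset _ _)) _)
    by_cases h3 : (ρ i).card = 1
    · have h4 : ρ i = {x} := by
        obtain ⟨y, hy⟩ := Finset.card_eq_one.1 h3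
        rw [hy] at hx ⊢
        rw [Finset.mem_singleton.1 hx]
      have h5 : (∅ : Finset σ) ∈ con x E := ⟨{x}, h4 ▸ h1 i hi, by simp⟩
      exact RegI.branch x hd' (s := 0) (RegI.of_empty_mem h5 0) (by omega)
    · have hle : ∀ j, ((ρ j).erase x).card ≤ (ρ j).card :=
        fun j => Finset.card_le_card (Finset.erase_subset _ _)
      have hc : RegI k (con x E) (1 + ∑ j ∈ T, (((ρ j).erase x).card - 1)) := by
        apply ih
        · have : ∑ j ∈ T, ((ρ j).erase x).card < ∑ j ∈ T, (ρ j).card := by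
            refine Finset.sum_lt_sum (fun j _ => hle j) ⟨i, hi, ?_⟩
            rw [Finset.card_erase_of_mem hx]; omega
          omega
        · intro j hj
          exact ⟨ρ j, h1 j hj, rfl⟩
        · rintro _ ⟨e, he, rfl⟩
          obtain ⟨j, hj, hje⟩ := h2 e he
          exact ⟨j, hj, Finset.erase_subset_erase _ hje⟩
      refine RegI.branch x hd' hc ?_
      have : ∑ j ∈ T, (((ρ j).erase x).card - 1) < ∑ j ∈ T, ((ρ j).card - 1) := by
        refine Finset.sum_lt_sum (fun j _ => Nat.sub_le_sub_right (hle j) 1) ⟨i, hi, ?_⟩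
        rw [Finset.card_erase_of_mem hx]; omega
      omega

end Ideals

section Min
variable {k σ : Type} [Field k]

lemma minFreeRes_bound (I : Ideal (MvPolynomial σ k))
    (hst : ∀ d, ∀ p ∈ I, (grR : Gr k σ _).π d p ∈ I) (hI : ∀ p ∈ I, constantCoeff p = 0) (r : ℕ)
    (hr : ∀ n, HasRes k σ n I (grR.sub I hst) (r + 1)) (F : MinFreeRes k σ I) (i : ℕ)
    (j : Fin (F.b i)) : F.deg i j ≤ r + i ∧ (i = 0 → F.deg i j = 0) := by
  classical
  have hmin : ∀ i z l, constantCoeff (F.d i z l) = 0 := by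
    intro i z l
    rw [LinearMap.pi_apply_eq_sum_univ (F.d i), Finset.sum_apply, map_sum]
    refine Finset.sum_eq_zero fun s _ => ?_
    have e : (fun j => if s = j then (1 : MvPolynomial σ k) else 0) = Pi.single s 1 := by
      ext j : 1
      simp [Pi.single_apply, eq_comm]
    rw [e, Pi.smul_apply, smul_eq_mul, map_mul, F.minimal, mul_zero]
  have hG : ∀ i, GHom (PI.free (F.deg (i + 1))) (PI.free (F.deg i)) (F.d i) := by
    intro i
    apply ghom_free
    intro j
    ext l : 1
    rw [free_π]
    obtain ⟨h1, h2⟩ := F.d_homog i j l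
    by_cases h : F.deg i l ≤ F.deg (i + 1) j
    · rw [if_pos h, homogeneousComponent_of_mem h1, if_pos rfl]
    · rw [if_neg h, h2 (not_le.1 h)]
  -- the zeroth step
  choose p hp hpa using F.aug_homog
  have hsum : ∀ z, F.aug z = Ideal.Quotient.mk I (∑ j, z j * p j) := by
    intro z
    rw [LinearMap.pi_apply_eq_sum_univ F.aug, map_sum]
    refine Finset.sum_congr rfl fun s _ => ?_
    have e : (fun j => if s = j then (1 : MvPolynomial σ k) else 0) = Pi.single s 1 := by
      ext j : 1
      simp [Pi.single_apply, eq_comm]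
    rw [e, hpa, map_mul]
    rfl
  have hker : ∀ z : Fin (F.b 0) → MvPolynomial σ k, (∑ j, z j * p j) ∈ I → ∀ l, constantCoeff (z l) = 0 := by
    intro z hz l
    have : F.aug z = 0 := by rw [hsum, Ideal.Quotient.eq_zero_iff_mem]; exact hz
    obtain ⟨y, rfl⟩ := (F.exact_zero _).1 this
    exact hmin _ _ _
  obtain ⟨z, hz⟩ := F.aug_surjective (Ideal.Quotient.mk I 1)
  rw [hsum, Ideal.Quotient.eq] at hz
  have hz1 := hI _ hz
  rw [map_sub, map_one, map_sum, sub_eq_zero] at hz1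
  have hex : ∃ j0, constantCoeff (p j0) ≠ 0 := by
    by_contra hcon
    push Not at hcon
    simp [hcon] at hz1
  obtain ⟨j0, hj0⟩ := hex
  have hdeg0 : F.deg 0 j0 = 0 := by
    by_contra h
    apply hj0
    rw [constantCoeff_eq]
    exact (hp j0).coeff_eq_zero (by simpa using Ne.symm h)
  have hpC : p j0 = C (constantCoeff (p j0)) := by
    have := hp j0
    rw [hdeg0] at this
    have h2 := totalDegree_eq_zero_iff_eq_C.1 (this.totalDegree_le.antisymm (Nat.zero_le _))
    exact h2
  set c := constantCoeff (p j0) with hc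
  have hcu : C c⁻¹ * (p j0) = (1 : MvPolynomial σ k) := by
    rw [hpC, ← C_mul, inv_mul_cancel₀ hj0, C_1]
  have huniq : ∀ l, l = j0 := by
    intro l
    by_contra hl
    have h1 := hker (Pi.single l 1 - Pi.single j0 (C c⁻¹ * p l)) (by
      have : ∑ j, (Pi.single l 1 - Pi.single j0 (C c⁻¹ * p l) : Fin (F.b 0) → MvPolynomial σ k) j
          * p j = 0 := by
        simp only [Pi.sub_apply, sub_mul, Finset.sum_sub_distrib, Pi.single_apply, ite_mul,
          zero_mul, one_mul, Finset.sum_ite_eq', Finset.mem_univ, if_true]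
        rw [mul_right_comm, hcu, one_mul, sub_self]
      rw [this]; exact I.zero_mem) l
    simp [hl] at h1
  have hsum' : ∀ z : Fin (F.b 0) → MvPolynomial σ k, ∑ j, z j * p j = z j0 * p j0 := by
    intro z
    exact Fintype.sum_eq_single j0 fun l hl => absurd (huniq l) hl
  -- image of d 0
  have hrange : ∀ z, z ∈ LinearMap.range (F.d 0) ↔ z j0 ∈ I := by
    intro z
    rw [LinearMap.mem_range]
    refine (F.exact_zero z).symm.trans ?_
    rw [hsum, Ideal.Quotient.eq_zero_iff_mem, hsum']
    constructor
    · intro h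
      have := I.mul_mem_left (C c⁻¹) h
      rwa [mul_left_comm, hcu, mul_one] at this
    · intro h
      exact I.mul_mem_right _ h
  have hres : ∀ i n, HasRes k σ n (LinearMap.range (F.d i)) ((PI.free (F.deg i)).sub _
      (range_stable (hG i))) (r + 1 + i) := by
    intro i
    induction i with
    | zero =>
      intro n
      refine HasRes.iso (LinearMap.codRestrict _ ((LinearMap.single (MvPolynomial σ k)
        (fun _ : Fin (F.b 0) => MvPolynomial σ k) j0) ∘ₗ I.subtype) ?_) ?_ ?_ (hr n)
      · intro x
        rw [hrange]
        simp
      · intro d m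
        apply Subtype.ext
        ext l : 1
        obtain rfl := huniq l
        rw [Gr.sub_coe, free_π, hdeg0]
        simp only [LinearMap.codRestrict_apply, LinearMap.comp_apply, LinearMap.coe_single,
          Pi.single_eq_same, Submodule.subtype_apply, Gr.sub_coe]
        simp [grR_π]
      · constructor
        · intro x y hxy
          have := congrFun (congrArg Subtype.val hxy) j0
          simp at this
          exact this
        · rintro ⟨z, hz⟩
          refine ⟨⟨z j0, (hrange z).1 hz⟩, Subtype.ext ?_⟩
          ext l : 1
          obtain rfl := huniq l
          simp
    | succ i ih =>
      intro n
      refine ((ih (n + 1)).min_step (F.deg (i + 1)) (F.d i).rangeRestrict ?_ ?_ _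
        (LinearMap.range (F.d (i + 1))).subtype (Gr.sub_subtype _ _ _)
        (Submodule.injective_subtype _) ?_ ?_).2
      · intro d m
        exact Subtype.ext (hG i d m)
      · exact LinearMap.surjective_rangeRestrict _
      · intro y
        have := F.exact_succ i y
        rw [← LinearMap.mem_ker, LinearMap.ker_rangeRestrict, LinearMap.mem_ker, this]
        simp
      · rintro ⟨_, z, rfl⟩ l
        exact hmin _ _ _
  cases i with
  | zero =>
    rw [huniq j, hdeg0]
    simp
  | succ i =>
    refine ⟨?_, by simp⟩
    have := ((hres i 1).min_step (F.deg (i + 1)) (F.d i).rangeRestrict (by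
        intro d m
        exact Subtype.ext (hG i d m)) (LinearMap.surjective_rangeRestrict _) _
        (LinearMap.range (F.d (i + 1))).subtype (Gr.sub_subtype _ _ (range_stable (hG (i + 1))))
        (Submodule.injective_subtype _) (by
          intro y
          have := F.exact_succ i y
          rw [← LinearMap.mem_ker, LinearMap.ker_rangeRestrict, LinearMap.mem_ker, this]
          simp) (by
          rintro ⟨_, z, rfl⟩ l
          exact hmin _ _ _)).1 j
    omega

lemma reg_le_of_regI (E : Set (Finset σ)) (hE : ∅ ∉ E) (r : ℕ) (h : RegI k E (r + 1)) :
    reg k σ (sqI k E) ≤ r := by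
  have hI : ∀ p ∈ sqI k E, constantCoeff p = 0 := by
    intro p hp
    rw [mem_sqI] at hp
    by_contra hne
    obtain ⟨e, he, h⟩ := hp 0 (by rwa [mem_support_iff])
    apply hE
    rcases e.eq_empty_or_nonempty with rfl | ⟨x, hx⟩
    · exact he
    · exact absurd rfl (h x hx)
  unfold reg
  rcases Set.eq_empty_or_nonempty {x : ℤ | ∃ F : MinFreeRes k σ (sqI k E), ∃ i : ℕ,
      ∃ j : Fin (F.b i), x = (F.deg i j : ℤ) - i} with h0 | h0
  · rw [h0, Int.csSup_empty]
    positivity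
  · apply csSup_le h0
    rintro _ ⟨F, i, j, rfl⟩
    have := (minFreeRes_bound (sqI k E) (sqI_stable E) hI r h F i j).1
    push_cast [← Int.ofNat_le] at this
    omega

end Min
end PI

namespace PI

section Tree
variable {V : Type} [DecidableEq V] (T : RTree V)

lemma iter_level (v : V) : T.parent^[T.level v] v = T.root := Nat.find_spec (T.reach v)

lemma iter_root (n : ℕ) : T.parent^[n] T.root = T.root := Function.iterate_fixed T.parent_root n

lemma level_root : T.level T.root = 0 := by
  unfold RTree.level
  rw [Nat.find_eq_zero]
  rfl

lemma eq_root_of_level {v : V} (h : T.level v = 0) : v = T.root := by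
  have := iter_level T v
  rwa [h] at this

lemma level_parent {v : V} (h : v ≠ T.root) : T.level v = T.level (T.parent v) + 1 := by
  apply le_antisymm
  · apply Nat.find_min'
    rw [Function.iterate_succ_apply]
    exact iter_level T _
  · have h0 : T.level v ≠ 0 := fun h0 => h (eq_root_of_level T h0)
    obtain ⟨m, hm⟩ := Nat.exists_eq_succ_of_ne_zero h0
    have h1 := iter_level T v
    rw [hm, Function.iterate_succ_apply] at h1
    have : T.level (T.parent v) ≤ m := Nat.find_min' _ h1
    omega

lemma level_iter (v : V) (j : ℕ) : T.level (T.parent^[j] v) = T.level v - j := by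
  induction j with
  | zero => rfl
  | succ j ih =>
    rw [Function.iterate_succ_apply']
    by_cases h : T.parent^[j] v = T.root
    · rw [h, level_root] at ih
      rw [h, T.parent_root, level_root]
      omega
    · have := level_parent T h
      omega

lemma iter_eq_or_lt {m : ℕ} {x y : V} (h : T.parent^[m] y = x) : y = x ∨ T.level x < T.level y := by
  by_cases hm : m = 0
  · subst hm; exact Or.inl h
  · by_cases hy : y = T.root
    · left
      rw [← h, hy, iter_root]
    · right
      have h1 := level_iter T y m
      rw [h] at h1
      have := level_parent T hy
      omega

/-- any iterate equals one with index at most the level -/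
lemma exists_iter_le (v : V) (m : ℕ) : ∃ m' ≤ T.level v, T.parent^[m'] v = T.parent^[m] v := by
  by_cases h : m ≤ T.level v
  · exact ⟨m, h, rfl⟩
  · refine ⟨T.level v, le_rfl, ?_⟩
    obtain ⟨c, rfl⟩ : ∃ c, m = c + T.level v := ⟨m - T.level v, by omega⟩
    rw [Function.iterate_add_apply, iter_level, iter_root]

variable [Fintype V]

lemma level_le (v : V) : T.level v ≤ T.height :=
  Finset.le_sup (f := fun v => T.level v) (Finset.mem_univ v)

/-- the vertices of the path on `t` vertices ending in `v` -/
def pset (t : ℕ) (v : V) : Finset V := (Finset.range t).image fun j => T.parent^[j] v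

lemma iter_injOn (t : ℕ) (v : V) (hv : t ≤ T.level v + 1) :
    Set.InjOn (fun j => T.parent^[j] v) (Finset.range t : Set ℕ) := by
  intro i hi j hj hij
  have h1 := level_iter T v i
  have h2 := level_iter T v j
  dsimp only at hij
  rw [hij] at h1
  simp at hi hj
  omega

lemma pathMonomial_eq (k : Type) [Field k] (t : ℕ) (v : V) (hv : t ≤ T.level v + 1) :
    T.pathMonomial k t v = ∏ u ∈ pset T t v, X u := by
  rw [pset, Finset.prod_image (iter_injOn T t v hv)]
  rfl

/-- the state of the branching -/
def fam (t : ℕ) (C D : Finset V) : Set (Finset V) :=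
  {e | ∃ v, t ≤ T.level v + 1 ∧ Disjoint (pset T t v) D ∧ e = pset T t v \ C}

lemma pathIdeal_eq (k : Type) [Field k] (t : ℕ) : T.pathIdeal k t = sqI k (fam T t ∅ ∅) := by
  unfold RTree.pathIdeal sqI
  congr 1
  ext m
  constructor
  · rintro ⟨v, hv, rfl⟩
    exact ⟨pset T t v, ⟨v, hv, by simp, by simp⟩, (pathMonomial_eq T k t v hv).symm⟩
  · rintro ⟨_, ⟨v, hv, _, rfl⟩, rfl⟩
    refine ⟨v, hv, ?_⟩
    rw [pathMonomial_eq T k t v hv]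
    simp

lemma con_fam (t : ℕ) (C D : Finset V) (x : V) : con x (fam T t C D) = fam T t (insert x C) D := by
  ext e
  constructor
  · rintro ⟨_, ⟨v, hv, hd, rfl⟩, rfl⟩
    exact ⟨v, hv, hd, (Finset.sdiff_insert _ _ _).symm⟩
  · rintro ⟨v, hv, hd, rfl⟩
    exact ⟨_, ⟨v, hv, hd, rfl⟩, (Finset.sdiff_insert _ _ _).symm⟩

lemma del_fam (t : ℕ) (C D : Finset V) (x : V) (hx : x ∉ C) :
    del x (fam T t C D) = fam T t C (insert x D) := by
  ext e
  constructor
  · rintro ⟨⟨v, hv, hd, rfl⟩, h⟩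
    refine ⟨v, hv, ?_, rfl⟩
    rw [Finset.disjoint_insert_right]
    exact ⟨fun h' => h (Finset.mem_sdiff.2 ⟨h', hx⟩), hd⟩
  · rintro ⟨v, hv, hd, rfl⟩
    rw [Finset.disjoint_insert_right] at hd
    exact ⟨⟨v, hv, hd.2, rfl⟩, fun h => hd.1 (Finset.mem_sdiff.1 h).1⟩

/-- the middle levels -/
noncomputable def mid (t : ℕ) : Finset V :=
  Finset.univ.filter fun u => T.height + 1 ≤ T.level u + t ∧ T.level u + 1 ≤ T.height

lemma mem_mid (t : ℕ) (u : V) :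
    u ∈ mid T t ↔ T.height + 1 ≤ T.level u + t ∧ T.level u + 1 ≤ T.height := by
  simp [mid]

def live (D : Finset V) (v : V) : Prop := ∀ j, T.parent^[j] v ∉ D

lemma mem_pset_of_anc {t : ℕ} {v d : V} {m : ℕ} (h : T.parent^[m] v = d)
    (hd : T.height + 1 ≤ T.level d + t) : d ∈ pset T t v := by
  obtain ⟨m', hm', h'⟩ := exists_iter_le T v m
  rw [h] at h'
  refine Finset.mem_image.2 ⟨m', ?_, h'⟩
  have h1 := level_iter T v m'
  rw [h'] at h1
  have := level_le T v
  simp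
  omega

open Classical in
noncomputable def wt (t : ℕ) (C D : Finset V) (u : V) : ℕ :=
  (if u ∈ mid T t ∧ u ∉ C then 1 else 0) +
    (if t ≤ T.level u + 1 ∧ T.level u + 2 ≤ T.height ∧ (∀ y, T.parent y = u → y ≠ T.root → y ∈ D)
      then T.height - T.level u - 1 else 0)

open Classical in
noncomputable def pot (t : ℕ) (C D : Finset V) : ℕ :=
  ∑ u with live T D u, wt T t C D u

open Classical in
noncomputable def below (x : V) : Finset V := Finset.univ.filter fun u => ∃ j, T.parent^[j] u = x

lemma mem_below (x u : V) : u ∈ below T x ↔ ∃ j, T.parent^[j] u = x := by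
  simp [below]

lemma chain (t : ℕ) (ht : T.height + 1 ≤ 2 * t) : ∀ (N : ℕ) (x : V), T.height - T.level x ≤ N →
    t ≤ T.level x → T.height - T.level x ≤ ∑ u ∈ below T x, wt T t ∅ ∅ u := by
  intro N
  induction N with
  | zero => intro x hN _; omega
  | succ N ih =>
    intro x hN hx
    by_cases hlt : T.height ≤ T.level x
    · omega
    have hmid : x ∈ mid T t := by rw [mem_mid]; omega
    have hxb : x ∈ below T x := (mem_below T x x).2 ⟨0, rfl⟩
    by_cases hleaf : ∀ y, T.parent y = x → y = T.root
    · have h1 : T.height - T.level x ≤ wt T t ∅ ∅ x := by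
        have h3 : ∀ y, T.parent y = x → y ≠ T.root → y ∈ (∅ : Finset V) :=
          fun y hy hy' => absurd (hleaf y hy) hy'
        unfold wt
        rw [if_pos ⟨hmid, by simp⟩]
        split_ifs with h2
        · omega
        · have : ¬ (T.level x + 2 ≤ T.height) := fun h => h2 ⟨by omega, h, h3⟩
          omega
      exact h1.trans (Finset.single_le_sum (fun _ _ => Nat.zero_le _) hxb)
    · push Not at hleaf
      obtain ⟨y, hy, hyr⟩ := hleaf
      have hly := level_parent T hyr
      rw [hy] at hly
      have h1 := ih y (by omega) (by omega)
      have hsub : below T y ⊆ (below T x).erase x := by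
        intro u hu
        obtain ⟨j, hj⟩ := (mem_below T y u).1 hu
        refine Finset.mem_erase.2 ⟨?_, (mem_below T x u).2 ⟨j + 1, ?_⟩⟩
        · rintro rfl
          have := level_iter T u j
          rw [hj] at this
          omega
        · rw [Function.iterate_succ_apply', hj, hy]
      have h2 := Finset.sum_le_sum_of_subset (f := wt T t ∅ ∅) hsub
      have h3 := Finset.add_sum_erase (below T x) (wt T t ∅ ∅) hxb
      have h4 : 1 ≤ wt T t ∅ ∅ x := by
        unfold wt
        rw [if_pos ⟨hmid, by simp⟩]
        omega
      omega

lemma pot_insert_C (t : ℕ) (C D : Finset V) (x : V) (hx : x ∈ mid T t) (hxC : x ∉ C)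
    (hl : live T D x) : pot T t (insert x C) D + 1 ≤ pot T t C D := by
  classical
  have : ∑ u with live T D u, wt T t (insert x C) D u < ∑ u with live T D u, wt T t C D u := by
    refine Finset.sum_lt_sum (fun u _ => ?_) ⟨x, by simp [hl], ?_⟩
    · unfold wt
      gcongr
      split_ifs with h1 h2
      · exact le_rfl
      · exact absurd ⟨h1.1, fun h => h1.2 (Finset.mem_insert_of_mem h)⟩ h2
      · omega
      · omega
    · unfold wt
      have e1 : (if x ∈ mid T t ∧ x ∉ insert x C then 1 else 0) = 0 := by simp
      have e2 : (if x ∈ mid T t ∧ x ∉ C then 1 else 0) = 1 := if_pos ⟨hx, hxC⟩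
      rw [e1, e2]
      omega
  unfold pot
  exact this

lemma pot_insert_C_dead (t : ℕ) (C D : Finset V) (x : V)
    (hl : ¬ live T D x) : pot T t (insert x C) D = pot T t C D := by
  classical
  unfold pot
  refine Finset.sum_congr rfl fun u hu => ?_
  have hux : u ≠ x := by
    rintro rfl
    exact hl (by simpa using hu)
  unfold wt
  simp [hux]

lemma pot_insert_D (t : ℕ) (ht : T.height + 1 ≤ 2 * t) (C D : Finset V) (x : V)
    (hxC : x ∉ C) (hxD : x ∉ D) (hl : live T D x)
    (hCD : ∀ a ∈ C ∪ D, T.level a ≤ T.level x) :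
    pot T t C (insert x D) ≤ pot T t C D := by
  classical
  have hbe : ∀ u ∈ below T x, u ∉ C ∪ D := by
    intro u hu hmem
    obtain ⟨j, hj⟩ := (mem_below T x u).1 hu
    rcases iter_eq_or_lt T hj with rfl | h
    · rcases Finset.mem_union.1 hmem with h | h
      · exact hxC h
      · exact hxD h
    · have := hCD u hmem
      omega
  have hbl : ∀ u ∈ below T x, live T D u := by
    intro u hu i hi
    obtain ⟨j, hj⟩ := (mem_below T x u).1 hu
    by_cases hij : j ≤ i
    · obtain ⟨c, rfl⟩ : ∃ c, i = c + j := ⟨i - j, by omega⟩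
      rw [Function.iterate_add_apply, hj] at hi
      exact hl c hi
    · refine hbe (T.parent^[i] u) ((mem_below T x _).2 ⟨j - i, ?_⟩) (Finset.mem_union_right _ hi)
      rw [← Function.iterate_add_apply, show j - i + i = j by omega, hj]
  have hsplit : pot T t C D = ∑ u with live T D u ∧ u ∉ below T x, wt T t C D u
      + ∑ u ∈ below T x, wt T t C D u := by
    unfold pot
    rw [← Finset.sum_filter_add_sum_filter_not _ (fun u => u ∉ below T x), Finset.filter_filter]
    congr 1
    refine Finset.sum_congr ?_ fun _ _ => rfl
    ext u
    simp only [Finset.mem_filter, Finset.mem_univ, true_and, not_not]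
    exact ⟨fun h => h.2, fun h => ⟨hbl u h, h⟩⟩
  have hlive : ∀ u, live T (insert x D) u ↔ live T D u ∧ u ∉ below T x := by
    intro u
    rw [mem_below]
    unfold live
    simp only [Finset.mem_insert, not_or, not_exists]
    exact ⟨fun h => ⟨fun j => (h j).2, fun j => (h j).1⟩, fun h j => ⟨h.2 j, h.1 j⟩⟩
  have hnew : pot T t C (insert x D) =
      ∑ u with live T D u ∧ u ∉ below T x, wt T t C (insert x D) u := by
    unfold pot
    refine Finset.sum_congr ?_ fun _ _ => rfl
    ext u
    simp [hlive]
  have hstep : ∀ u, u ∉ below T x → wt T t C (insert x D) u ≤ wt T t C D u +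
      if u = T.parent x then (if t ≤ T.level x then T.height - T.level x else 0) else 0 := by
    intro u hu
    by_cases hup : u = T.parent x
    · have hxr : x ≠ T.root := by
        rintro rfl
        apply hu
        rw [hup, T.parent_root]
        exact (mem_below T _ _).2 ⟨0, rfl⟩
      have hlx := level_parent T hxr
      rw [← hup] at hlx
      rw [if_pos hup]
      unfold wt
      rw [add_assoc]
      gcongr
      split_ifs <;> omega
    · rw [if_neg hup, add_zero]
      unfold wt
      gcongr
      split_ifs with h1 h2
      · exact le_rfl
      · exfalso
        apply h2
        refine ⟨h1.1, h1.2.1, fun y hy hyr => ?_⟩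
        rcases Finset.mem_insert.1 (h1.2.2 y hy hyr) with rfl | h
        · exact absurd hy.symm hup
        · exact h
      · omega
      · omega
  have hsum1 : ∑ u with live T D u ∧ u ∉ below T x, wt T t C (insert x D) u ≤
      ∑ u with live T D u ∧ u ∉ below T x, wt T t C D u +
      (if t ≤ T.level x then T.height - T.level x else 0) := by
    calc _ ≤ ∑ u with live T D u ∧ u ∉ below T x, (wt T t C D u +
          if u = T.parent x then (if t ≤ T.level x then T.height - T.level x else 0) else 0) :=
          Finset.sum_le_sum fun u hu => hstep u (Finset.mem_filter.1 hu).2.2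
      _ ≤ _ := by
        rw [Finset.sum_add_distrib, Finset.sum_ite_eq']
        gcongr
        split_ifs <;> omega
  have hsum2 : (if t ≤ T.level x then T.height - T.level x else 0) ≤
      ∑ u ∈ below T x, wt T t C D u := by
    split_ifs with h
    · refine (chain T t ht _ x le_rfl h).trans (Finset.sum_le_sum fun u hu => ?_)
      have hu' := hbe u hu
      rw [Finset.mem_union, not_or] at hu'
      unfold wt
      gcongr ?_ + ?_
      · simp [hu'.1]
      · split_ifs with h1 h2
        · exact le_rfl
        · exfalso
          exact h2 ⟨h1.1, h1.2.1, fun y hy hyr => absurd (h1.2.2 y hy hyr) (by simp)⟩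
        · omega
        · omega
    · omega
  rw [hnew, hsplit]
  omega

lemma terminal (k : Type) [Field k] (t : ℕ) (ht : T.height + 1 ≤ 2 * t)
    (C D : Finset V) (hD : D ⊆ mid T t) (hW : mid T t ⊆ C ∪ D) :
    RegI k (fam T t C D) (1 + pot T t C D) := by
  classical
  let S : Finset V := Finset.univ.filter fun v => t ≤ T.level v + 1 ∧ live T D v ∧
    (T.height ≤ T.level v + 1 ∨ ∀ y, T.parent y = v → y ≠ T.root → y ∈ D)
  have hlive : ∀ v, Disjoint (pset T t v) D → live T D v := by
    intro v hv j hj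
    have h1 := ((mem_mid T t _).1 (hD hj)).1
    exact Finset.disjoint_left.1 hv (mem_pset_of_anc T rfl h1) hj
  have hfind : ∀ (N : ℕ) (v : V), T.height - T.level v ≤ N → t ≤ T.level v + 1 → live T D v →
      ∃ w ∈ S, pset T t w \ C ⊆ pset T t v \ C := by
    intro N
    induction N with
    | zero =>
      intro v hN hv hl
      exact ⟨v, by simp [S]; exact ⟨hv, hl, by omega⟩, subset_rfl⟩
    | succ N ih =>
      intro v hN hv hl
      by_cases hvS : v ∈ S
      · exact ⟨v, hvS, subset_rfl⟩
      have h1 : ¬ (T.height ≤ T.level v + 1 ∨ ∀ y, T.parent y = v → y ≠ T.root → y ∈ D) :=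
        fun h => hvS (Finset.mem_filter.2 ⟨Finset.mem_univ _, hv, hl, h⟩)
      push Not at h1
      obtain ⟨h2, y, hy, hyr, hyD⟩ := h1
      have hly := level_parent T hyr
      rw [hy] at hly
      have hyl : live T D y := by
        intro j
        cases j with
        | zero => exact hyD
        | succ j => rw [Function.iterate_succ_apply, hy]; exact hl j
      have hyC : y ∈ C := by
        have : y ∈ mid T t := by rw [mem_mid]; omega
        exact (Finset.mem_union.1 (hW this)).resolve_right hyD
      obtain ⟨w, hw, hws⟩ := ih y (by omega) (by omega) hyl
      refine ⟨w, hw, hws.trans ?_⟩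
      intro z hz
      obtain ⟨hz1, hz2⟩ := Finset.mem_sdiff.1 hz
      obtain ⟨j, hj, hjz⟩ := Finset.mem_image.1 hz1
      refine Finset.mem_sdiff.2 ⟨?_, hz2⟩
      cases j with
      | zero =>
        exfalso
        apply hz2
        rw [← hjz]
        exact hyC
      | succ j =>
        refine Finset.mem_image.2 ⟨j, ?_, ?_⟩
        · simp at hj ⊢; omega
        · rw [← hjz, Function.iterate_succ_apply, hy]
  have hreg : RegI k (fam T t C D) (1 + ∑ v ∈ S, ((pset T t v \ C).card - 1)) := by
    refine RegI.of_gens _ _ S (fun v => pset T t v \ C) le_rfl ?_ ?_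
    · intro v hv
      obtain ⟨-, h1, h2, -⟩ := Finset.mem_filter.1 hv
      refine ⟨v, h1, ?_, rfl⟩
      rw [Finset.disjoint_left]
      intro z hz
      obtain ⟨j, -, rfl⟩ := Finset.mem_image.1 hz
      exact h2 j
    · rintro e ⟨v, hv, hd, rfl⟩
      exact hfind _ v le_rfl hv (hlive v hd)
  refine hreg.mono (Nat.add_le_add_left ?_ 1)
  have hcard : ∀ v ∈ S, (pset T t v \ C).card - 1 ≤ wt T t C D v := by
    intro v hv
    obtain ⟨-, h1, h2, h3⟩ := Finset.mem_filter.1 hv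
    have hlv := level_le T v
    have hnot : ∀ j, T.parent^[j] v ∉ C → ¬ (T.height + 1 ≤ T.level v - j + t ∧
        T.level v - j + 1 ≤ T.height) := by
      intro j hj hc
      rw [← level_iter T v j, ← mem_mid] at hc
      rcases Finset.mem_union.1 (hW hc) with h | h
      · exact hj h
      · exact h2 j h
    have hb : (pset T t v \ C).card ≤ 1 ∨ (pset T t v \ C).card ≤ T.height - T.level v := by
      by_cases hv : T.level v = T.height
      · left
        refine (Finset.card_le_card (t := {v}) ?_).trans (by simp)
        intro z hz
        obtain ⟨hz1, hz2⟩ := Finset.mem_sdiff.1 hz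
        obtain ⟨j, hj, rfl⟩ := Finset.mem_image.1 hz1
        have := hnot j hz2
        simp at hj
        have : j = 0 := by omega
        subst this
        simp
      · right
        have hsub : pset T t v \ C ⊆ (Finset.Ico (T.level v + t - T.height) t).image
            (fun j => T.parent^[j] v) := by
          intro z hz
          obtain ⟨hz1, hz2⟩ := Finset.mem_sdiff.1 hz
          obtain ⟨j, hj, rfl⟩ := Finset.mem_image.1 hz1
          have := hnot j hz2
          simp at hj
          refine Finset.mem_image.2 ⟨j, ?_, rfl⟩
          simp
          omega
        refine (Finset.card_le_card hsub).trans (Finset.card_image_le.trans ?_)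
        simp
        omega
    unfold wt
    by_cases h4 : T.height ≤ T.level v + 1
    · omega
    · rw [if_pos (c := t ≤ T.level v + 1 ∧ _) ⟨h1, by omega, h3.resolve_left h4⟩]
      omega
  unfold pot
  refine (Finset.sum_le_sum hcard).trans (Finset.sum_le_sum_of_subset ?_)
  intro v hv
  simp only [Finset.mem_filter, Finset.mem_univ, true_and]
  exact (Finset.mem_filter.1 hv).2.2.1

lemma main_ind (k : Type) [Field k] (t : ℕ) (ht : T.height + 1 ≤ 2 * t) : ∀ (N : ℕ)
    (C D : Finset V), (mid T t \ (C ∪ D)).card ≤ N → D ⊆ mid T t →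
    (∀ a ∈ C ∪ D, ∀ b ∈ mid T t \ (C ∪ D), T.level a ≤ T.level b) →
    RegI k (fam T t C D) (1 + pot T t C D) := by
  intro N
  induction N with
  | zero =>
    intro C D hN hD _
    apply terminal T k t ht C D hD
    rw [← Finset.sdiff_eq_empty_iff_subset, ← Finset.card_eq_zero]
    omega
  | succ N ih =>
    intro C D hN hD hinv
    rcases (mid T t \ (C ∪ D)).eq_empty_or_nonempty with h0 | h0
    · exact terminal T k t ht C D hD (Finset.sdiff_eq_empty_iff_subset.1 h0)
    obtain ⟨x, hx, hxmin⟩ := Finset.exists_min_image _ T.level h0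
    obtain ⟨hxW, hxCD⟩ := Finset.mem_sdiff.1 hx
    have hxC : x ∉ C := fun h => hxCD (Finset.mem_union_left _ h)
    have hxD : x ∉ D := fun h => hxCD (Finset.mem_union_right _ h)
    have hlt : (mid T t \ insert x (C ∪ D)).card ≤ N := by
      rw [Finset.sdiff_insert, Finset.card_erase_of_mem hx]
      omega
    have hinv' : ∀ a ∈ insert x (C ∪ D), ∀ b ∈ mid T t \ insert x (C ∪ D),
        T.level a ≤ T.level b := by
      intro a ha b hb
      rw [Finset.sdiff_insert] at hb
      have hb' := Finset.mem_of_mem_erase hb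
      rcases Finset.mem_insert.1 ha with rfl | ha
      · exact hxmin b hb'
      · exact hinv a ha b hb'
    have e1 : insert x C ∪ D = insert x (C ∪ D) := Finset.insert_union _ _ _
    have e2 : C ∪ insert x D = insert x (C ∪ D) := Finset.union_insert _ _ _
    have hc := ih (insert x C) D (by rwa [e1]) hD (by rwa [e1])
    by_cases hl : live T D x
    · have hd := ih C (insert x D) (by rwa [e2]) (Finset.insert_subset hxW hD) (by rwa [e2])
      rw [← con_fam] at hc
      rw [← del_fam T t C D x hxC] at hd
      have p1 := pot_insert_C T t C D x hxW hxC hl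
      have p2 := pot_insert_D T t ht C D x hxC hxD hl (fun a ha => hinv a ha x hx)
      exact RegI.branch x (hd.mono (by omega)) hc (by omega)
    · rw [pot_insert_C_dead T t C D x hl] at hc
      have : fam T t (insert x C) D = fam T t C D := by
        ext e
        have key : ∀ v, Disjoint (pset T t v) D → pset T t v \ insert x C = pset T t v \ C := by
          intro v hv
          rw [Finset.sdiff_insert, Finset.erase_eq_of_notMem]
          intro hmem
          obtain ⟨j, -, hj⟩ := Finset.mem_image.1 (Finset.mem_sdiff.1 hmem).1
          apply hl
          intro i hi
          have h1 := ((mem_mid T t _).1 (hD hi)).1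
          refine Finset.disjoint_left.1 hv (mem_pset_of_anc T (m := i + j) ?_ h1) hi
          rw [Function.iterate_add_apply]
          exact congrArg _ hj
        constructor
        · rintro ⟨v, hv, hd, rfl⟩
          exact ⟨v, hv, hd, key v hd⟩
        · rintro ⟨v, hv, hd, rfl⟩
          exact ⟨v, hv, hd, (key v hd).symm⟩
      rwa [this] at hc

lemma pot_empty (t : ℕ) (ht2 : t ≤ T.height + 1) :
    ((pot T t ∅ ∅ : ℕ) : ℤ) ≤ (if t = T.height + 1 then 1 else 0) +
        (∑ x : V, (if T.height ≤ T.level x + t ∧ T.level x + 2 ≤ T.height then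
          (T.outdeg x : ℤ) else 0)) +
        ∑ i ∈ (Finset.range T.height).filter (fun i => t - 1 ≤ i ∧ i + 2 ≤ T.height),
          ((T.height - i - 1) * Nat.card {y : V // T.IsLeaf y ∧ T.level y = i} : ℤ) := by
  classical
  have h0 : pot T t ∅ ∅ = (mid T t).card + ∑ u, (if t ≤ T.level u + 1 ∧ T.level u + 2 ≤ T.height ∧
      T.IsLeaf u then T.height - T.level u - 1 else 0) := by
    unfold pot
    rw [Finset.filter_true_of_mem (by intro u _ j; simp)]
    unfold wt
    rw [Finset.sum_add_distrib, Finset.card_eq_sum_ones, ← Finset.sum_filter]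
    congr 1
    · refine Finset.sum_congr ?_ fun _ _ => rfl
      ext u; simp
    · refine Finset.sum_congr rfl fun u _ => ?_
      refine if_congr ?_ rfl rfl
      simp only [RTree.IsLeaf, Finset.notMem_empty, imp_false, not_not]
  rw [h0]
  push_cast
  gcongr ?_ + ?_
  · have hout : ∀ x, T.outdeg x = ∑ y, if T.parent y = x ∧ y ≠ T.root then 1 else 0 := by
      intro x
      unfold RTree.outdeg
      rw [Nat.card_eq_fintype_card, Fintype.card_subtype, Finset.card_eq_sum_ones,
        Finset.sum_filter]
    have h1 : ∑ x : V, (if T.height ≤ T.level x + t ∧ T.level x + 2 ≤ T.height then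
          T.outdeg x else 0) = (Finset.univ.filter fun y => y ≠ T.root ∧
          T.height ≤ T.level (T.parent y) + t ∧ T.level (T.parent y) + 2 ≤ T.height).card := by
      rw [Finset.card_eq_sum_ones, Finset.sum_filter]
      have : ∀ x, (if T.height ≤ T.level x + t ∧ T.level x + 2 ≤ T.height then
          T.outdeg x else 0) = ∑ y, if T.parent y = x then (if y ≠ T.root ∧
          T.height ≤ T.level (T.parent y) + t ∧ T.level (T.parent y) + 2 ≤ T.height then 1 else 0)
          else 0 := by
        intro x
        rw [hout]
        split_ifs with h
        · refine Finset.sum_congr rfl fun y _ => ?_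
          by_cases hy : T.parent y = x
          · subst hy; simp [h]
          · simp [hy]
        · symm
          refine Finset.sum_eq_zero fun y _ => ?_
          by_cases hy : T.parent y = x
          · subst hy; simp [h]
          · simp [hy]
      simp_rw [this]
      rw [Finset.sum_comm]
      refine Finset.sum_congr rfl fun y _ => ?_
      rw [Finset.sum_ite_eq]
      simp
    have h2 : (mid T t).card ≤ (if t = T.height + 1 then 1 else 0) +
        ∑ x : V, (if T.height ≤ T.level x + t ∧ T.level x + 2 ≤ T.height then
          T.outdeg x else 0) := by
      rw [h1]
      have hsub : mid T t ⊆ (if t = T.height + 1 then {T.root} else ∅) ∪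
          (Finset.univ.filter fun y => y ≠ T.root ∧
          T.height ≤ T.level (T.parent y) + t ∧ T.level (T.parent y) + 2 ≤ T.height) := by
        intro u hu
        rw [mem_mid] at hu
        by_cases hur : u = T.root
        · rw [hur, level_root] at hu
          rw [if_pos (by omega), hur]
          simp
        · apply Finset.mem_union_right
          have := level_parent T hur
          simp only [Finset.mem_filter, Finset.mem_univ, true_and]
          exact ⟨hur, by omega, by omega⟩
      refine (Finset.card_le_card hsub).trans ((Finset.card_union_le _ _).trans ?_)
      gcongr
      split_ifs <;> simp
    have h3 := (Int.ofNat_le.2 h2)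
    push_cast at h3
    exact h3
  · apply le_of_eq
    have hcard : ∀ i, (Nat.card {y : V // T.IsLeaf y ∧ T.level y = i} : ℤ) =
        ∑ y, if T.IsLeaf y ∧ T.level y = i then 1 else 0 := by
      intro i
      rw [Nat.card_eq_fintype_card, Fintype.card_subtype, Finset.card_eq_sum_ones,
        Finset.sum_filter]
      push_cast
      rfl
    simp_rw [hcard, Finset.mul_sum]
    rw [Finset.sum_comm]
    refine Finset.sum_congr rfl fun u _ => ?_
    have : ∀ i : ℕ, ((T.height : ℤ) - i - 1) * (if T.IsLeaf u ∧ T.level u = i then 1 else 0) =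
        if T.level u = i then (if T.IsLeaf u then ((T.height : ℤ) - T.level u - 1) else 0) else 0 := by
      intro i
      by_cases h1 : T.level u = i
      · subst h1
        by_cases h2 : T.IsLeaf u <;> simp [h2]
      · simp [h1]
    simp_rw [this]
    rw [Finset.sum_ite_eq]
    simp only [Finset.mem_filter, Finset.mem_range]
    by_cases h2 : T.IsLeaf u
    · by_cases h3 : t ≤ T.level u + 1 ∧ T.level u + 2 ≤ T.height
      · rw [if_pos ⟨h3.1, h3.2, h2⟩, if_pos ⟨by omega, by omega, by omega⟩, if_pos h2]
        omega
      · rw [if_neg (fun h => h3 ⟨h.1, h.2.1⟩), if_neg (fun h => h3 ⟨by omega, by omega⟩)]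
    · simp [h2]

end Tree
end PI

/-- Theorem C: for a rooted tree of height `h ≥ 1` and `⌈(h+1)/2⌉ ≤ t ≤ h + 1`,
`reg(R/I_t(Γ)) ≤ Σ_{h-t ≤ ℓ(x) ≤ h-2} deg⁺(x) + Σ_{i=t-1}^{h-2} (h-i-1)·l_i(Γ)`,
where `l_i(Γ)` is the number of leaves at level `i` (with the convention that the
virtual vertex at level `-1`, occurring exactly when `t = h + 1`, has outdegree `1`). -/
theorem reg_path_ideal_le
    {k V : Type} [Field k] [Fintype V] [DecidableEq V] (T : RTree V)
    (hh : 1 ≤ T.height)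
    (t : ℕ) (ht1 : (T.height + 2) / 2 ≤ t) (ht2 : t ≤ T.height + 1) :
    reg k V (T.pathIdeal k t) ≤
      (if t = T.height + 1 then 1 else 0) +
        (∑ x : V, (if T.height ≤ T.level x + t ∧ T.level x + 2 ≤ T.height then
          (T.outdeg x : ℤ) else 0)) +
        ∑ i ∈ (Finset.range T.height).filter (fun i => t - 1 ≤ i ∧ i + 2 ≤ T.height),
          ((T.height - i - 1) * Nat.card {y : V // T.IsLeaf y ∧ T.level y = i} : ℤ) := by
  refine le_trans ?_ (PI.pot_empty T t ht2)
  rw [PI.pathIdeal_eq]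
  apply PI.reg_le_of_regI
  · rintro ⟨v, _, _, h⟩
    have : v ∈ PI.pset T t v := Finset.mem_image.2 ⟨0, by simp; omega, rfl⟩
    rw [Finset.sdiff_empty] at h
    rw [← h] at this
    simp at this
  · rw [add_comm]
    exact PI.main_ind T k t (by omega) _ ∅ ∅ le_rfl (by simp) (by simp)
end

section
/- Let P_n be the directed path on n vertices x_0 → x_1 → ⋯ → x_{n−1} and 2 ≤ t ≤ n. Then reg(R/I_t(P_n)) = (t−1)·⌈(n−t+1)/(t+1)⌉. -/
open MvPolynomial

namespace PathReg

open MvPolynomial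

section basics
variable {k σ : Type} [Field k]

/-- Homogeneous vectors of degree `e` in a free module with generators in degrees `b`. -/
def HV {β : Type} (b : β → ℕ) (e : ℕ) (w : β → MvPolynomial σ k) : Prop :=
  ∀ l, (w l).IsHomogeneous (e - b l) ∧ (e < b l → w l = 0)

/-- The degree `e` part of a polynomial, shifted by `a`. -/
noncomputable def hp (e a : ℕ) (p : MvPolynomial σ k) : MvPolynomial σ k :=
  if a ≤ e then homogeneousComponent (e - a) p else 0

theorem hc_mul (p q : MvPolynomial σ k) (a m : ℕ) (hq : q.IsHomogeneous a) :
    homogeneousComponent m (p * q) =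
      if a ≤ m then homogeneousComponent (m - a) p * q else 0 := by
  conv_lhs => rw [← sum_homogeneousComponent p, Finset.sum_mul, map_sum]
  have h1 : ∀ i ∈ Finset.range (p.totalDegree + 1),
      homogeneousComponent m (homogeneousComponent i p * q) =
        if i + a = m then homogeneousComponent i p * q else 0 := by
    intro i _
    have := homogeneousComponent_of_mem (m := m)
      ((homogeneousComponent_isHomogeneous i p).mul hq)
    rw [this]
    simp only [eq_comm]
  rw [Finset.sum_congr rfl h1]
  split_ifs with h
  · by_cases h2 : m - a < p.totalDegree + 1
    · rw [Finset.sum_eq_single (m - a)]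
      · rw [if_pos (by omega)]
      · intro b _ hb
        rw [if_neg (by omega)]
      · intro hb
        exact absurd (Finset.mem_range.mpr h2) hb
    · rw [homogeneousComponent_eq_zero _ _ (by omega), zero_mul]
      apply Finset.sum_eq_zero
      intro b hb
      rw [Finset.mem_range] at hb
      rw [if_neg (by omega)]
  · apply Finset.sum_eq_zero
    intro b _
    rw [if_neg (by omega)]

theorem hp_mul (p q : MvPolynomial σ k) (e a b : ℕ) (hq : q.IsHomogeneous (a - b))
    (hq0 : a < b → q = 0) : hp e b (p * q) = hp e a p * q := by
  by_cases hab : a < b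
  · rw [hq0 hab]; simp [hp]
  · unfold hp
    rw [hc_mul p q _ _ hq]
    split_ifs with h1 h2 h3 h4
    all_goals first | (exfalso; omega) | skip
    · have : e - b - (a - b) = e - a := by omega
      rw [this]
    all_goals simp

theorem hp_sum {ι : Type} (s : Finset ι) (f : ι → MvPolynomial σ k) (e b : ℕ) :
    hp e b (∑ i ∈ s, f i) = ∑ i ∈ s, hp e b (f i) := by
  unfold hp
  split_ifs <;> simp

theorem HV_hp {β : Type} (b : β → ℕ) (e : ℕ) (w : β → MvPolynomial σ k) :
    HV b e (fun l => hp e (b l) (w l)) := by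
  intro l
  simp only [hp]
  split_ifs with h
  · exact ⟨homogeneousComponent_isHomogeneous _ _, fun h' => absurd h (by omega)⟩
  · exact ⟨isHomogeneous_zero _ _ _, fun _ => rfl⟩

theorem hp_of_HV {β : Type} {b : β → ℕ} {e : ℕ} {w : β → MvPolynomial σ k} (h : HV b e w) :
    (fun l => hp e (b l) (w l)) = w := by
  funext l
  unfold hp
  split_ifs with h1
  · rw [homogeneousComponent_of_mem (h l).1, if_pos rfl]
  · exact ((h l).2 (by omega)).symm

theorem lin_apply {α β : Type} [Fintype α] [DecidableEq α]
    (f : (α → MvPolynomial σ k) →ₗ[MvPolynomial σ k] (β → MvPolynomial σ k))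
    (w : α → MvPolynomial σ k) (l : β) :
    f w l = ∑ j, w j * f (Pi.single j 1) l := by
  conv_lhs => rw [pi_eq_sum_univ' w, map_sum]
  rw [Finset.sum_apply]
  apply Finset.sum_congr rfl
  intro j _
  rw [map_smul, Pi.smul_apply, smul_eq_mul]

theorem lift_homog {α β : Type} [Fintype α] [DecidableEq α] (a : α → ℕ) (b : β → ℕ)
    (g : (α → MvPolynomial σ k) →ₗ[MvPolynomial σ k] (β → MvPolynomial σ k))
    (hg : ∀ j, HV b (a j) (g (Pi.single j 1))) (e : ℕ) (z : β → MvPolynomial σ k)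
    (hz : HV b e z) (hy : ∃ y, g y = z) : ∃ y, g y = z ∧ HV a e y := by
  obtain ⟨y, rfl⟩ := hy
  refine ⟨fun l => hp e (a l) (y l), ?_, HV_hp _ _ _⟩
  rw [← hp_of_HV hz]
  funext l
  rw [lin_apply, lin_apply g y l, hp_sum]
  apply Finset.sum_congr rfl
  intro j _
  rw [hp_mul _ _ _ _ _ (hg j l).1 (hg j l).2]

theorem exists_lin {α β : Type} [Fintype α] [DecidableEq α]
    (v : α → (β → MvPolynomial σ k)) :
    ∃ f : (α → MvPolynomial σ k) →ₗ[MvPolynomial σ k] (β → MvPolynomial σ k),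
      ∀ j, f (Pi.single j 1) = v j := by
  refine ⟨(Pi.basisFun (MvPolynomial σ k) α).constr (MvPolynomial σ k) v, fun j => ?_⟩
  have := (Pi.basisFun (MvPolynomial σ k) α).constr_basis (MvPolynomial σ k) v j
  rwa [Pi.basisFun_apply] at this

theorem lin_ext {α M : Type} [Fintype α] [DecidableEq α] [AddCommGroup M]
    [Module (MvPolynomial σ k) M]
    (f g : (α → MvPolynomial σ k) →ₗ[MvPolynomial σ k] M)
    (h : ∀ j, f (Pi.single j 1) = g (Pi.single j 1)) : f = g := by
  apply (Pi.basisFun (MvPolynomial σ k) α).ext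
  intro j
  rw [Pi.basisFun_apply]
  exact h j

theorem dep_choice {T : ℕ → Type} (Q : ∀ i, T i → Prop) (S : ∀ i, T i → T (i + 1) → Prop)
    (t0 : T 0) (h0 : Q 0 t0)
    (step : ∀ i t, Q i t → ∃ t', Q (i + 1) t' ∧ S i t t') :
    ∃ f : ∀ i, T i, f 0 = t0 ∧ (∀ i, Q i (f i)) ∧ ∀ i, S i (f i) (f (i + 1)) := by
  choose g hg using step
  let F : ∀ i, {t : T i // Q i t} := fun i =>
    Nat.rec ⟨t0, h0⟩ (fun i t => ⟨g i t.1 t.2, (hg i t.1 t.2).1⟩) i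
  exact ⟨fun i => (F i).1, rfl, fun i => (F i).2, fun i => (hg i (F i).1 (F i).2).2⟩

/-- Graded comparison theorem. -/
theorem lift_graded {α β : ℕ → Type} [∀ i, Fintype (α i)] [∀ i, DecidableEq (α i)]
    [∀ i, Fintype (β i)] [∀ i, DecidableEq (β i)]
    (a : ∀ i, α i → ℕ) (b : ∀ i, β i → ℕ)
    (dA : ∀ i, (α (i + 1) → MvPolynomial σ k) →ₗ[MvPolynomial σ k] (α i → MvPolynomial σ k))
    (dB : ∀ i, (β (i + 1) → MvPolynomial σ k) →ₗ[MvPolynomial σ k] (β i → MvPolynomial σ k))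
    (hA : ∀ i x, dA i (dA (i + 1) x) = 0)
    (hB : ∀ i, Function.Exact (dB (i + 1)) (dB i))
    (gA : ∀ i j, HV (a i) (a (i + 1) j) (dA i (Pi.single j 1)))
    (gB : ∀ i j, HV (b i) (b (i + 1) j) (dB i (Pi.single j 1)))
    (c : ℕ) (f0 : (α 0 → MvPolynomial σ k) →ₗ[MvPolynomial σ k] (β 0 → MvPolynomial σ k))
    (h0 : ∀ x, ∃ y, dB 0 y = f0 (dA 0 x))
    (g0 : ∀ j, HV (b 0) (a 0 j + c) (f0 (Pi.single j 1))) :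
    ∃ f : ∀ i, (α i → MvPolynomial σ k) →ₗ[MvPolynomial σ k] (β i → MvPolynomial σ k),
      f 0 = f0 ∧ (∀ i j, HV (b i) (a i j + c) (f i (Pi.single j 1))) ∧
      ∀ i x, dB i (f (i + 1) x) = f i (dA i x) := by
  refine Exists.elim (dep_choice
    (T := fun i => (α i → MvPolynomial σ k) →ₗ[MvPolynomial σ k] (β i → MvPolynomial σ k))
    (fun i f => (∀ x, ∃ y, dB i y = f (dA i x)) ∧
      ∀ j, HV (b i) (a i j + c) (f (Pi.single j 1)))
    (fun i f f' => ∀ x, dB i (f' x) = f (dA i x)) f0 ⟨h0, g0⟩ ?_) ?_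
  rotate_left
  · rintro f ⟨hf0, hf1, hf2⟩
    exact ⟨f, hf0, fun i => (hf1 i).2, hf2⟩
  · rintro i f ⟨h1, h2⟩
    have h3 : ∀ j, HV (b i) (a (i + 1) j + c) (f (dA i (Pi.single j 1))) := by
      intro j l
      rw [lin_apply]
      have h4 : ∀ m, (dA i (Pi.single j 1) m * f (Pi.single m 1) l).IsHomogeneous
          (a (i + 1) j + c - b i l) ∧ (a (i + 1) j + c < b i l →
            dA i (Pi.single j 1) m * f (Pi.single m 1) l = 0) := by
        intro m
        have q1 := gA i j m
        have q2 := h2 m l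
        by_cases c1 : a (i + 1) j < a i m
        · rw [q1.2 c1, zero_mul]
          exact ⟨isHomogeneous_zero _ _ _, fun _ => rfl⟩
        by_cases c2 : a i m + c < b i l
        · rw [q2.2 c2, mul_zero]
          exact ⟨isHomogeneous_zero _ _ _, fun _ => rfl⟩
        refine ⟨?_, fun h => by omega⟩
        have := q1.1.mul q2.1
        convert this using 1
        omega
      exact ⟨IsHomogeneous.sum _ _ _ fun m _ => (h4 m).1,
        fun h => Finset.sum_eq_zero fun m _ => (h4 m).2 h⟩
    have h5 : ∀ j, ∃ y, dB i y = f (dA i (Pi.single j 1)) ∧ HV (b (i + 1)) (a (i + 1) j + c) y :=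
      fun j => lift_homog _ _ (dB i) (gB i) _ _ (h3 j) (h1 _)
    choose v hv using h5
    obtain ⟨f', hf'⟩ := exists_lin v
    have h6 : ∀ x, dB i (f' x) = f (dA i x) := by
      have : dB i ∘ₗ f' = f ∘ₗ dA i := by
        apply lin_ext
        intro j
        simp only [LinearMap.comp_apply, hf', (hv j).1]
      intro x
      exact LinearMap.congr_fun this x
    refine ⟨f', ⟨fun x => ?_, fun j => ?_⟩, h6⟩
    · have : dB i (f' (dA (i + 1) x)) = 0 := by rw [h6, hA, map_zero]
      exact (hB i _).1 this
    · rw [hf']; exact (hv j).2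

/-- Ungraded comparison theorem. -/
theorem lift_ungraded {α β : ℕ → Type} [∀ i, Fintype (α i)] [∀ i, DecidableEq (α i)]
    (dA : ∀ i, (α (i + 1) → MvPolynomial σ k) →ₗ[MvPolynomial σ k] (α i → MvPolynomial σ k))
    (dB : ∀ i, (β (i + 1) → MvPolynomial σ k) →ₗ[MvPolynomial σ k] (β i → MvPolynomial σ k))
    (hA : ∀ i x, dA i (dA (i + 1) x) = 0)
    (hB : ∀ i, Function.Exact (dB (i + 1)) (dB i))
    (f0 : (α 0 → MvPolynomial σ k) →ₗ[MvPolynomial σ k] (β 0 → MvPolynomial σ k))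
    (h0 : ∀ x, ∃ y, dB 0 y = f0 (dA 0 x)) :
    ∃ f : ∀ i, (α i → MvPolynomial σ k) →ₗ[MvPolynomial σ k] (β i → MvPolynomial σ k),
      f 0 = f0 ∧ ∀ i x, dB i (f (i + 1) x) = f i (dA i x) := by
  refine Exists.elim (dep_choice
    (T := fun i => (α i → MvPolynomial σ k) →ₗ[MvPolynomial σ k] (β i → MvPolynomial σ k))
    (fun i f => (∀ x, ∃ y, dB i y = f (dA i x)))
    (fun i f f' => ∀ x, dB i (f' x) = f (dA i x)) f0 h0 ?_) ?_
  rotate_left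
  · rintro f ⟨hf0, hf1, hf2⟩
    exact ⟨f, hf0, hf2⟩
  · rintro i f h1
    choose v hv using fun j => h1 (Pi.single j 1)
    obtain ⟨f', hf'⟩ := exists_lin v
    have h6 : ∀ x, dB i (f' x) = f (dA i x) := by
      have : dB i ∘ₗ f' = f ∘ₗ dA i := by
        apply lin_ext
        intro j
        simp only [LinearMap.comp_apply, hf', hv j]
      intro x
      exact LinearMap.congr_fun this x
    refine ⟨f', fun x => ?_, h6⟩
    have : dB i (f' (dA (i + 1) x)) = 0 := by rw [h6, hA, map_zero]
    exact (hB i _).1 this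

/-- Null-homotopy of chain maps which vanish on homology. -/
theorem homotopy {α : ℕ → Type} [∀ i, Fintype (α i)] [∀ i, DecidableEq (α i)]
    (d : ∀ i, (α (i + 1) → MvPolynomial σ k) →ₗ[MvPolynomial σ k] (α i → MvPolynomial σ k))
    (hd : ∀ i, Function.Exact (d (i + 1)) (d i))
    (f : ∀ i, (α i → MvPolynomial σ k) →ₗ[MvPolynomial σ k] (α i → MvPolynomial σ k))
    (hf : ∀ i x, d i (f (i + 1) x) = f i (d i x))
    (h0 : ∀ x, ∃ y, d 0 y = f 0 x) :
    ∃ h : ∀ i, (α i → MvPolynomial σ k) →ₗ[MvPolynomial σ k] (α (i + 1) → MvPolynomial σ k),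
      (∀ x, d 0 (h 0 x) = f 0 x) ∧
      ∀ i x, d (i + 1) (h (i + 1) x) + h i (d i x) = f (i + 1) x := by
  choose v hv using fun j => h0 (Pi.single j 1)
  obtain ⟨g, hg⟩ := exists_lin v
  have hg' : ∀ x, d 0 (g x) = f 0 x := by
    have : d 0 ∘ₗ g = f 0 := by
      apply lin_ext
      intro j
      simp only [LinearMap.comp_apply, hg, hv j]
    intro x
    exact LinearMap.congr_fun this x
  refine Exists.elim (dep_choice
    (T := fun i => (α i → MvPolynomial σ k) →ₗ[MvPolynomial σ k] (α (i + 1) → MvPolynomial σ k))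
    (fun i h => ∀ x, d i (h (d i x)) = f i (d i x))
    (fun i h h' => ∀ x, d (i + 1) (h' x) + h (d i x) = f (i + 1) x) g
    (fun x => hg' _) ?_) ?_
  rotate_left
  · rintro h ⟨hh0, hh1, hh2⟩
    refine ⟨h, ?_, hh2⟩
    rw [hh0]; exact hg'
  · intro i h h1
    have h2 : ∀ j, ∃ y, d (i + 1) y =
        f (i + 1) (Pi.single j 1) - h (d i (Pi.single j 1)) := by
      intro j
      apply (hd i _).1
      rw [map_sub, hf, h1, sub_self]
    choose v hv using h2
    obtain ⟨g, hg⟩ := exists_lin v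
    have h3 : ∀ x, d (i + 1) (g x) + h (d i x) = f (i + 1) x := by
      have : d (i + 1) ∘ₗ g + h ∘ₗ d i = f (i + 1) := by
        apply lin_ext
        intro j
        simp only [LinearMap.add_apply, LinearMap.comp_apply, hg, hv j, sub_add_cancel]
      intro x
      exact LinearMap.congr_fun this x
    refine ⟨g, fun x => ?_, h3⟩
    have := h3 (d (i + 1) x)
    rw [(hd i).apply_apply_eq_zero, map_zero, add_zero] at this
    exact this

end basics


section res
variable {k σ : Type} [Field k]

/-- Minimal graded free resolutions of `R/I` with `F₀ = R`, on arbitrary finite index types. -/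
structure GRes (k σ : Type) [Field k] (I : Ideal (MvPolynomial σ k)) where
  ι : ℕ → Type
  fin : ∀ i, Fintype (ι i)
  dec : ∀ i, DecidableEq (ι i)
  deg : ∀ i, ι i → ℕ
  d : ∀ i, (ι (i + 1) → MvPolynomial σ k) →ₗ[MvPolynomial σ k] (ι i → MvPolynomial σ k)
  o : ι 0
  ho : ∀ j, j = o
  deg_o : deg 0 o = 0
  exact_zero : ∀ w : ι 0 → MvPolynomial σ k, w o ∈ I ↔ ∃ a, d 0 a = w
  exact_succ : ∀ i, Function.Exact (d (i + 1)) (d i)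
  homog : ∀ i j, HV (deg i) (deg (i + 1) j) (d i (Pi.single j 1))
  minimal : ∀ i j l, constantCoeff (d i (Pi.single j 1) l) = 0

attribute [instance] GRes.fin GRes.dec

theorem cc_lin {α β : Type} [Fintype α] [DecidableEq α]
    (f : (α → MvPolynomial σ k) →ₗ[MvPolynomial σ k] (β → MvPolynomial σ k))
    (w : α → MvPolynomial σ k) (l : β) :
    constantCoeff (f w l) =
      ∑ j, constantCoeff (w j) * constantCoeff (f (Pi.single j 1) l) := by
  rw [lin_apply, map_sum]
  simp only [map_mul]

theorem deg_unique (I : Ideal (MvPolynomial σ k)) (F : MinFreeRes k σ I) (G : GRes k σ I)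
    (i : ℕ) (j : Fin (F.b i)) : ∃ l : G.ι i, G.deg i l = F.deg i j := by
  have hFd : ∀ i x, F.d i (F.d (i + 1) x) = 0 := fun i x =>
    (F.exact_succ i).apply_apply_eq_zero x
  have hGd : ∀ i x, G.d i (G.d (i + 1) x) = 0 := fun i x =>
    (G.exact_succ i).apply_apply_eq_zero x
  choose p hp1 hp2 using F.aug_homog
  obtain ⟨a0, ha0⟩ := exists_lin (β := G.ι 0) (fun j => fun _ => p j)
  obtain ⟨y, hy⟩ := F.aug_surjective (Ideal.Quotient.mk I 1)
  obtain ⟨b0, hb0⟩ := exists_lin (α := G.ι 0) (fun _ => y)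
  have haug : ∀ x, F.aug x = Ideal.Quotient.mk I (a0 x G.o) := by
    have : F.aug = (I.mkQ ∘ₗ LinearMap.proj G.o) ∘ₗ a0 := by
      apply lin_ext
      intro j
      simp only [LinearMap.comp_apply, ha0, hp2]
      rfl
    intro x
    exact LinearMap.congr_fun this x
  have hbaug : ∀ x, F.aug (b0 x) = Ideal.Quotient.mk I (x G.o) := by
    have : F.aug ∘ₗ b0 = (I.mkQ ∘ₗ LinearMap.proj G.o) := by
      apply lin_ext
      intro j
      simp only [LinearMap.comp_apply, hb0, hy]
      rw [G.ho j]
      simp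
    intro x
    exact LinearMap.congr_fun this x
  obtain ⟨a, ha1, ha2, ha3⟩ := lift_graded (α := fun i => Fin (F.b i)) (β := G.ι) F.deg G.deg F.d G.d hFd G.exact_succ
    (fun i j l => F.d_homog i j l) G.homog 0 a0
    (by
      intro x
      rw [← G.exact_zero, ← Ideal.Quotient.eq_zero_iff_mem, ← haug]
      exact F.exact_zero.apply_apply_eq_zero x)
    (by
      intro j l
      rw [ha0, G.ho l, G.deg_o]
      exact ⟨hp1 j, fun h => absurd h (by omega)⟩)
  obtain ⟨b, hb1, hb2⟩ := lift_ungraded (α := G.ι) (β := fun i => Fin (F.b i)) G.d F.d hGd F.exact_succ b0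
    (by
      intro x
      apply (F.exact_zero _).1
      rw [hbaug, Ideal.Quotient.eq_zero_iff_mem, G.exact_zero]
      exact ⟨x, rfl⟩)
  obtain ⟨h, hh1, hh2⟩ := homotopy (α := fun i => Fin (F.b i)) F.d F.exact_succ (fun i => b i ∘ₗ a i - LinearMap.id)
    (by
      intro i x
      simp only [LinearMap.sub_apply, LinearMap.comp_apply, LinearMap.id_apply, map_sub, hb2, ha3])
    (by
      intro x
      apply (F.exact_zero _).1
      simp only [LinearMap.sub_apply, LinearMap.comp_apply, LinearMap.id_apply, map_sub, hb1, ha1]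
      rw [hbaug, haug, sub_self])
  have key : constantCoeff ((b i (a i (Pi.single j 1)) - Pi.single j 1 : Fin (F.b i) → _) j) = 0 := by
    have hdh : ∀ i w l, constantCoeff (F.d i w l) = 0 := by
      intro i w l
      rw [cc_lin]
      apply Finset.sum_eq_zero
      intro m _
      rw [F.minimal, mul_zero]
    cases i with
    | zero =>
      have := hh1 (Pi.single j 1)
      simp only [LinearMap.sub_apply, LinearMap.comp_apply, LinearMap.id_apply] at this
      rw [← this, hdh]
    | succ i =>
      have := hh2 i (Pi.single j 1)
      simp only [LinearMap.sub_apply, LinearMap.comp_apply, LinearMap.id_apply] at this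
      rw [← this, Pi.add_apply, map_add, hdh, cc_lin, zero_add]
      apply Finset.sum_eq_zero
      intro m _
      rw [F.minimal, zero_mul]
  rw [Pi.sub_apply, map_sub, Pi.single_eq_same, map_one, sub_eq_zero, cc_lin] at key
  obtain ⟨l, _, hl⟩ := Finset.exists_ne_zero_of_sum_ne_zero (key.trans_ne one_ne_zero)
  have hl' := left_ne_zero_of_mul hl
  have h1 := ha2 i j l
  refine ⟨l, ?_⟩
  have h2 : ¬ (F.deg i j + 0 < G.deg i l) := by
    intro hlt
    rw [h1.2 hlt, map_zero] at hl'
    exact hl' rfl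
  have h3 := h1.1.coeff_eq_zero (d := 0)
  by_contra h4
  apply hl'
  rw [constantCoeff_eq]
  apply h3
  simp
  omega

noncomputable def GRes.toMin {I : Ideal (MvPolynomial σ k)} (G : GRes k σ I) :
    MinFreeRes k σ I where
  b i := Fintype.card (G.ι i)
  deg i j := G.deg i ((Fintype.equivFin (G.ι i)).symm j)
  d i := (LinearEquiv.funCongrLeft (MvPolynomial σ k) (MvPolynomial σ k)
      (Fintype.equivFin (G.ι i)).symm).toLinearMap ∘ₗ G.d i ∘ₗ
      (LinearEquiv.funCongrLeft (MvPolynomial σ k) (MvPolynomial σ k)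
        (Fintype.equivFin (G.ι (i + 1)))).toLinearMap
  aug := (I.mkQ ∘ₗ LinearMap.proj G.o) ∘ₗ
      (LinearEquiv.funCongrLeft (MvPolynomial σ k) (MvPolynomial σ k)
        (Fintype.equivFin (G.ι 0))).toLinearMap
  aug_surjective := by
    intro x
    obtain ⟨r, rfl⟩ := Ideal.Quotient.mk_surjective x
    exact ⟨fun _ => r, rfl⟩
  exact_zero := by
    intro x
    have h1 := G.exact_zero (fun l => x (Fintype.equivFin (G.ι 0) l))
    rw [← Ideal.Quotient.eq_zero_iff_mem] at h1
    refine Iff.trans h1 ⟨?_, ?_⟩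
    · rintro ⟨a, ha⟩
      refine ⟨fun l => a ((Fintype.equivFin _).symm l), ?_⟩
      funext l
      simp [LinearMap.funLeft, Function.comp_def, ha]
    · rintro ⟨a, rfl⟩
      refine ⟨fun l => a (Fintype.equivFin _ l), ?_⟩
      funext l
      simp [LinearMap.funLeft, Function.comp_def]
  exact_succ := by
    intro i x
    have h1 := G.exact_succ i (fun l => x (Fintype.equivFin _ l))
    refine Iff.trans ?_ (h1.trans ⟨?_, ?_⟩)
    · constructor
      · intro h
        funext l
        have := congr_fun h (Fintype.equivFin _ l)
        simpa [LinearMap.funLeft, Function.comp_def] using this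
      · intro h
        funext l
        have := congr_fun h ((Fintype.equivFin _).symm l)
        simpa [LinearMap.funLeft, Function.comp_def] using this
    · rintro ⟨a, ha⟩
      refine ⟨fun l => a ((Fintype.equivFin _).symm l), ?_⟩
      funext l
      simp [LinearMap.funLeft, Function.comp_def, ha]
    · rintro ⟨a, rfl⟩
      refine ⟨fun l => a (Fintype.equivFin _ l), ?_⟩
      funext l
      simp [LinearMap.funLeft, Function.comp_def]
  aug_homog := by
    intro j
    refine ⟨1, ?_, ?_⟩
    · rw [G.ho ((Fintype.equivFin (G.ι 0)).symm j), G.deg_o]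
      exact isHomogeneous_one _ _
    · have : Fintype.equivFin (G.ι 0) G.o = j := by
        rw [← G.ho ((Fintype.equivFin (G.ι 0)).symm j), Equiv.apply_symm_apply]
      simp [LinearMap.funLeft, this]
  d_homog := by
    intro i j l
    have h1 := G.homog i ((Fintype.equivFin _).symm j) ((Fintype.equivFin _).symm l)
    have h2 : (LinearEquiv.funCongrLeft (MvPolynomial σ k) (MvPolynomial σ k)
        (Fintype.equivFin (G.ι (i + 1)))) (Pi.single j 1) =
        Pi.single ((Fintype.equivFin _).symm j) 1 := by
      funext m
      simp [LinearMap.funLeft, Pi.single_apply, Equiv.eq_symm_apply]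
    simp only [LinearMap.comp_apply, LinearEquiv.coe_coe, h2]
    exact h1
  minimal := by
    intro i j l
    have h1 := G.minimal i ((Fintype.equivFin _).symm j) ((Fintype.equivFin _).symm l)
    have h2 : (LinearEquiv.funCongrLeft (MvPolynomial σ k) (MvPolynomial σ k)
        (Fintype.equivFin (G.ι (i + 1)))) (Pi.single j 1) =
        Pi.single ((Fintype.equivFin _).symm j) 1 := by
      funext m
      simp [LinearMap.funLeft, Pi.single_apply, Equiv.eq_symm_apply]
    simp only [LinearMap.comp_apply, LinearEquiv.coe_coe, h2]
    exact h1

/-- `R/I` has a minimal graded free resolution whose regularity is `r`. -/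
def Rg (I : Ideal (MvPolynomial σ k)) (r : ℕ) : Prop :=
  ∃ G : GRes k σ I, (∀ i j, G.deg i j ≤ r + i) ∧ ∃ i j, G.deg i j = r + i

theorem Rg.reg_eq {I : Ideal (MvPolynomial σ k)} {r : ℕ} (h : Rg I r) :
    reg k σ I = (r : ℤ) := by
  obtain ⟨G, h1, i, j, h2⟩ := h
  apply IsGreatest.csSup_eq
  constructor
  · refine ⟨G.toMin, i, Fintype.equivFin (G.ι i) j, ?_⟩
    simp [GRes.toMin, h2]
  · rintro x ⟨F, i, j, rfl⟩
    obtain ⟨l, hl⟩ := deg_unique I F G i j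
    have := h1 i l
    omega

end res

section cone
variable {k σ : Type} [Field k]

/-- Index types of the mapping cone. -/
def coneι (A B : ℕ → Type) : ℕ → Type
  | 0 => A 0
  | i + 1 => A (i + 1) ⊕ B i

instance coneFin (A B : ℕ → Type) [∀ i, Fintype (A i)] [∀ i, Fintype (B i)] :
    ∀ i, Fintype (coneι A B i)
  | 0 => inferInstanceAs (Fintype (A 0))
  | i + 1 => inferInstanceAs (Fintype (A (i + 1) ⊕ B i))

instance coneDec (A B : ℕ → Type) [∀ i, DecidableEq (A i)] [∀ i, DecidableEq (B i)] :
    ∀ i, DecidableEq (coneι A B i)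
  | 0 => inferInstanceAs (DecidableEq (A 0))
  | i + 1 => inferInstanceAs (DecidableEq (A (i + 1) ⊕ B i))

/-- Degrees of the generators of the mapping cone. -/
def coneDeg (A B : ℕ → Type) (a : ∀ i, A i → ℕ) (b : ∀ i, B i → ℕ) (c : ℕ) :
    ∀ i, coneι A B i → ℕ
  | 0 => a 0
  | i + 1 => Sum.elim (a (i + 1)) (fun j => b i j + c)

/-- Differential of the mapping cone. -/
noncomputable def coneD (A B : ℕ → Type)
    (dA : ∀ i, (A (i + 1) → MvPolynomial σ k) →ₗ[MvPolynomial σ k] (A i → MvPolynomial σ k))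
    (dB : ∀ i, (B (i + 1) → MvPolynomial σ k) →ₗ[MvPolynomial σ k] (B i → MvPolynomial σ k))
    (f : ∀ i, (B i → MvPolynomial σ k) →ₗ[MvPolynomial σ k] (A i → MvPolynomial σ k)) :
    ∀ i, (coneι A B (i + 1) → MvPolynomial σ k) →ₗ[MvPolynomial σ k]
      (coneι A B i → MvPolynomial σ k)
  | 0 => (dA 0).coprod (f 0) ∘ₗ
      (LinearEquiv.sumArrowLequivProdArrow (A 1) (B 0) (MvPolynomial σ k)
        (MvPolynomial σ k)).toLinearMap
  | i + 1 => (LinearEquiv.sumArrowLequivProdArrow (A (i + 1)) (B i) (MvPolynomial σ k)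
        (MvPolynomial σ k)).symm.toLinearMap ∘ₗ
      (((dA (i + 1)).coprod (f (i + 1))).prod (-(dB i ∘ₗ LinearMap.snd _ _ _))) ∘ₗ
      (LinearEquiv.sumArrowLequivProdArrow (A (i + 2)) (B (i + 1)) (MvPolynomial σ k)
        (MvPolynomial σ k)).toLinearMap

section
variable {A B : ℕ → Type}
    {dA : ∀ i, (A (i + 1) → MvPolynomial σ k) →ₗ[MvPolynomial σ k] (A i → MvPolynomial σ k)}
    {dB : ∀ i, (B (i + 1) → MvPolynomial σ k) →ₗ[MvPolynomial σ k] (B i → MvPolynomial σ k)}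
    {f : ∀ i, (B i → MvPolynomial σ k) →ₗ[MvPolynomial σ k] (A i → MvPolynomial σ k)}

theorem coneD_zero (u : A 1 → MvPolynomial σ k) (w : B 0 → MvPolynomial σ k) :
    coneD A B dA dB f 0 (Sum.elim u w : A 1 ⊕ B 0 → MvPolynomial σ k) = dA 0 u + f 0 w := rfl

theorem coneD_succ (i : ℕ) (u : A (i + 2) → MvPolynomial σ k)
    (w : B (i + 1) → MvPolynomial σ k) :
    coneD A B dA dB f (i + 1) (Sum.elim u w : A (i + 2) ⊕ B (i + 1) → MvPolynomial σ k) =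
      (Sum.elim (dA (i + 1) u + f (i + 1) w) (-(dB i w)) :
        A (i + 1) ⊕ B i → MvPolynomial σ k) := rfl

theorem single_inl {α β : Type} [DecidableEq α] [DecidableEq β] (j : α) :
    (Pi.single (Sum.inl j) 1 : α ⊕ β → MvPolynomial σ k) =
      Sum.elim (Pi.single j 1) (0 : β → MvPolynomial σ k) := by
  funext x
  cases x <;> simp [Pi.single_apply]

theorem single_inr {α β : Type} [DecidableEq α] [DecidableEq β] (j : β) :
    (Pi.single (Sum.inr j) 1 : α ⊕ β → MvPolynomial σ k) =
      Sum.elim (0 : α → MvPolynomial σ k) (Pi.single j 1) := by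
  funext x
  cases x <;> simp [Pi.single_apply]

theorem sum_eta {α β : Type} (x : α ⊕ β → MvPolynomial σ k) :
    ∃ u w, x = Sum.elim u w := ⟨x ∘ Sum.inl, x ∘ Sum.inr, (Sum.elim_comp_inl_inr x).symm⟩

end

theorem HV_zero {β : Type} (b : β → ℕ) (e : ℕ) : HV b e (0 : β → MvPolynomial σ k) :=
  fun _ => ⟨isHomogeneous_zero _ _ _, fun _ => rfl⟩

theorem exists_elim_eq {α β : Type} {u u' : α → MvPolynomial σ k} {w w' : β → MvPolynomial σ k}
    (h1 : u = u') (h2 : w = w') : (Sum.elim u w : α ⊕ β → MvPolynomial σ k) = Sum.elim u' w' := by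
  rw [h1, h2]

/-- The mapping cone resolution. -/
noncomputable def cone {I J : Ideal (MvPolynomial σ k)} (A : GRes k σ I) (B : GRes k σ J)
    (m : MvPolynomial σ k) (c : ℕ)
    (f : ∀ i, (B.ι i → MvPolynomial σ k) →ₗ[MvPolynomial σ k] (A.ι i → MvPolynomial σ k))
    (hf0 : ∀ w, f 0 w = fun _ => m * w B.o)
    (hf1 : ∀ i j, HV (A.deg i) (B.deg i j + c) (f i (Pi.single j 1)))
    (hf2 : ∀ i x, A.d i (f (i + 1) x) = f i (B.d i x))
    (hf3 : ∀ i j l, constantCoeff (f i (Pi.single j 1) l) = 0)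
    (hm : ∀ r, m * r ∈ I → r ∈ J) : GRes k σ (I ⊔ Ideal.span {m}) where
  ι := coneι A.ι B.ι
  fin := coneFin A.ι B.ι
  dec := coneDec A.ι B.ι
  deg := coneDeg A.ι B.ι A.deg B.deg c
  d := coneD A.ι B.ι A.d B.d f
  o := A.o
  ho := A.ho
  deg_o := A.deg_o
  exact_zero := by
    intro w
    constructor
    · intro h
      obtain ⟨p, hp, q, hq, hpq⟩ := Submodule.mem_sup.1 h
      obtain ⟨r, rfl⟩ := Ideal.mem_span_singleton'.1 hq
      obtain ⟨a, ha⟩ := (A.exact_zero (fun _ => p)).1 hp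
      refine ⟨(Sum.elim a (fun _ => r) : A.ι 1 ⊕ B.ι 0 → _), ?_⟩
      rw [coneD_zero, ha, hf0]
      funext l
      rw [A.ho l, ← hpq, mul_comm r m]
      rfl
    · rintro ⟨x, rfl⟩
      obtain ⟨u, w, rfl⟩ := sum_eta (α := A.ι 1) (β := B.ι 0) x
      rw [coneD_zero, hf0]
      refine Submodule.add_mem_sup ((A.exact_zero _).2 ⟨u, rfl⟩) ?_
      exact Ideal.mul_mem_right _ _ (Ideal.mem_span_singleton_self m)
  exact_succ := by
    intro i x
    have hBB : ∀ i x, B.d i (B.d (i + 1) x) = 0 := fun i x =>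
      (B.exact_succ i).apply_apply_eq_zero x
    have hAA : ∀ i x, A.d i (A.d (i + 1) x) = 0 := fun i x =>
      (A.exact_succ i).apply_apply_eq_zero x
    obtain ⟨u, w, rfl⟩ := sum_eta (α := A.ι (i + 1)) (β := B.ι i) x
    -- common finishing argument
    have fin : ∀ w' , B.d i w' = w → A.d i u + f i w = 0 → (Sum.elim u w :
        A.ι (i + 1) ⊕ B.ι i → MvPolynomial σ k) ∈
        Set.range (coneD A.ι B.ι A.d B.d f (i + 1)) := by
      intro w' hw' h
      have h1 : A.d i (u + f (i + 1) w') = 0 := by rw [map_add, hf2, hw', h]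
      obtain ⟨u', hu'⟩ := (A.exact_succ i _).1 h1
      refine ⟨(Sum.elim u' (-w') : A.ι (i + 2) ⊕ B.ι (i + 1) → _), ?_⟩
      rw [coneD_succ]
      apply exists_elim_eq
      · rw [hu', map_neg]; abel
      · rw [map_neg, neg_neg, hw']
    cases i with
    | zero =>
      constructor
      · intro h
        rw [coneD_zero] at h
        have h1 : ∃ y, A.d 0 y = f 0 w := ⟨-u, by
          rw [map_neg]; exact neg_eq_of_add_eq_zero_right h⟩
        rw [← A.exact_zero, hf0] at h1
        obtain ⟨w', hw'⟩ := (B.exact_zero w).1 (hm _ h1)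
        exact fin w' hw' h
      · rintro ⟨y, hy⟩
        obtain ⟨u', w', rfl⟩ := sum_eta (α := A.ι 2) (β := B.ι 1) y
        rw [← hy, coneD_succ, coneD_zero, map_add, hAA, hf2, map_neg]
        abel
    | succ i =>
      constructor
      · intro h
        rw [coneD_succ] at h
        have h1 : A.d (i + 1) u + f (i + 1) w = 0 := by
          funext l; exact congr_fun h (Sum.inl l)
        have h2 : B.d i w = 0 := by
          rw [← neg_eq_zero]
          funext l; exact congr_fun h (Sum.inr l)
        obtain ⟨w', hw'⟩ := (B.exact_succ i w).1 h2
        exact fin w' hw' h1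
      · rintro ⟨y, hy⟩
        obtain ⟨u', w', rfl⟩ := sum_eta (α := A.ι (i + 3)) (β := B.ι (i + 2)) y
        rw [← hy, coneD_succ, coneD_succ, map_add, hAA, hf2, map_neg, map_neg, hBB]
        simp only [zero_add, add_neg_cancel, neg_zero]
        funext l
        cases l <;> rfl
  homog := by
    intro i j
    cases i with
    | zero =>
      rcases j with j | j
      · suffices key : HV (A.deg 0) (A.deg 1 j) (coneD A.ι B.ι A.d B.d f 0
          (Pi.single (Sum.inl j) 1 : A.ι 1 ⊕ B.ι 0 → _)) from key
        rw [single_inl, coneD_zero, map_zero, add_zero]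
        exact A.homog 0 j
      · suffices key : HV (A.deg 0) (B.deg 0 j + c) (coneD A.ι B.ι A.d B.d f 0
          (Pi.single (Sum.inr j) 1 : A.ι 1 ⊕ B.ι 0 → _)) from key
        rw [single_inr, coneD_zero, map_zero, zero_add]
        exact hf1 0 j
    | succ i =>
      rcases j with j | j
      · suffices key : HV (Sum.elim (A.deg (i + 1)) (fun j => B.deg i j + c)) (A.deg (i + 2) j) (coneD A.ι B.ι A.d B.d f (i + 1)
          (Pi.single (Sum.inl j) 1 : A.ι (i + 2) ⊕ B.ι (i + 1) → _)) from key
        rw [single_inl, coneD_succ, map_zero, add_zero, map_zero, neg_zero]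
        rintro (l | l)
        · exact A.homog (i + 1) j l
        · exact HV_zero (fun j => B.deg i j + c) _ l
      · suffices key : HV (Sum.elim (A.deg (i + 1)) (fun j => B.deg i j + c)) (B.deg (i + 1) j + c) (coneD A.ι B.ι A.d B.d f (i + 1)
          (Pi.single (Sum.inr j) 1 : A.ι (i + 2) ⊕ B.ι (i + 1) → _)) from key
        rw [single_inr, coneD_succ, map_zero, zero_add]
        rintro (l | l)
        · exact hf1 (i + 1) j l
        · have := B.homog i j l
          change (-(B.d i (Pi.single j 1) l)).IsHomogeneous
            (B.deg (i + 1) j + c - (B.deg i l + c)) ∧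
            (B.deg (i + 1) j + c < B.deg i l + c → -(B.d i (Pi.single j 1) l) = 0)
          rw [Nat.add_sub_add_right]
          refine ⟨this.1.neg, fun h => ?_⟩
          rw [this.2 (by omega), neg_zero]
  minimal := by
    intro i j l
    cases i with
    | zero =>
      rcases j with j | j
      · change constantCoeff (coneD A.ι B.ι A.d B.d f 0
          (Pi.single (Sum.inl j) 1 : A.ι 1 ⊕ B.ι 0 → _) l) = 0
        rw [single_inl, coneD_zero, map_zero, add_zero]
        exact A.minimal 0 j l
      · change constantCoeff (coneD A.ι B.ι A.d B.d f 0
          (Pi.single (Sum.inr j) 1 : A.ι 1 ⊕ B.ι 0 → _) l) = 0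
        rw [single_inr, coneD_zero, map_zero, zero_add]
        exact hf3 0 j l
    | succ i =>
      rcases j with j | j
      · change constantCoeff (coneD A.ι B.ι A.d B.d f (i + 1)
          (Pi.single (Sum.inl j) 1 : A.ι (i + 2) ⊕ B.ι (i + 1) → _) l) = 0
        rw [single_inl, coneD_succ, map_zero, add_zero, map_zero, neg_zero]
        rcases l with l | l
        · exact A.minimal (i + 1) j l
        · exact map_zero _
      · change constantCoeff (coneD A.ι B.ι A.d B.d f (i + 1)
          (Pi.single (Sum.inr j) 1 : A.ι (i + 2) ⊕ B.ι (i + 1) → _) l) = 0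
        rw [single_inr, coneD_succ, map_zero, zero_add]
        rcases l with l | l
        · exact hf3 (i + 1) j l
        · have := B.minimal i j l
          change constantCoeff (-(B.d i (Pi.single j 1) l)) = 0
          rw [map_neg, this, neg_zero]

theorem Rg_cone {I J : Ideal (MvPolynomial σ k)} {r s : ℕ} (hI : Rg I r) (hJ : Rg J s)
    (v : σ) (m : MvPolynomial σ k) (c : ℕ) (hmc : m.IsHomogeneous c)
    (h1 : ∀ p ∈ J, m * p ∈ I) (h2 : ∀ p, X v * m * p ∈ I → p ∈ J) :
    Rg (I ⊔ Ideal.span {X v * m}) (max r (s + c)) := by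
  obtain ⟨A, hA1, iA, jA, hA2⟩ := hI
  obtain ⟨B, hB1, iB, jB, hB2⟩ := hJ
  obtain ⟨f0, hf0⟩ := exists_lin (α := B.ι 0) (β := A.ι 0) (fun _ _ => m)
  have hf0' : ∀ w l, f0 w l = m * w B.o := by
    intro w l
    rw [lin_apply, Finset.sum_eq_single B.o]
    · rw [hf0, mul_comm]
    · intro b _ hb
      exact absurd (B.ho b) hb
    · intro h
      exact absurd (Finset.mem_univ _) h
  obtain ⟨f, hf1, hf2, hf3⟩ := lift_graded (α := B.ι) (β := A.ι) B.deg A.deg B.d A.d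
    (fun i x => (B.exact_succ i).apply_apply_eq_zero x) A.exact_succ B.homog A.homog c f0
    (by
      intro x
      rw [← A.exact_zero, hf0']
      exact h1 _ ((B.exact_zero _).2 ⟨x, rfl⟩))
    (by
      intro j l
      rw [hf0, B.ho j, B.deg_o, A.ho l, A.deg_o]
      exact ⟨by simpa using hmc, fun h => absurd h (by omega)⟩)
  let C := cone A B (X v * m) (c + 1) (fun i => (X v : MvPolynomial σ k) • f i)
    (by
      intro w
      funext l
      simp only [LinearMap.smul_apply, Pi.smul_apply, smul_eq_mul, hf1, hf0']
      ring)
    (by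
      intro i j l
      simp only [LinearMap.smul_apply, Pi.smul_apply, smul_eq_mul]
      have := hf2 i j l
      by_cases h : B.deg i j + c < A.deg i l
      · rw [this.2 h, mul_zero]
        exact ⟨isHomogeneous_zero _ _ _, fun _ => rfl⟩
      · refine ⟨?_, fun h' => absurd h' (by omega)⟩
        have h3 := (isHomogeneous_X k v).mul this.1
        convert h3 using 1
        omega)
    (by
      intro i x
      simp only [LinearMap.smul_apply, map_smul, hf3])
    (by
      intro i j l
      simp only [LinearMap.smul_apply, Pi.smul_apply, smul_eq_mul, map_mul, constantCoeff_X,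
        zero_mul])
    h2
  refine ⟨C, ?_, ?_⟩
  · intro i j
    cases i with
    | zero =>
      have := hA1 0 j
      change A.deg 0 j ≤ _
      omega
    | succ i =>
      rcases j with j | j
      · have := hA1 (i + 1) j
        change A.deg (i + 1) j ≤ _
        omega
      · have := hB1 i j
        change B.deg i j + (c + 1) ≤ _
        omega
  · rcases le_total (s + c) r with h | h
    · rw [max_eq_left h]
      cases iA with
      | zero => exact ⟨0, jA, hA2⟩
      | succ i => exact ⟨i + 1, Sum.inl jA, hA2⟩
    · rw [max_eq_right h]
      refine ⟨iB + 1, Sum.inr jB, ?_⟩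
      change B.deg iB jB + (c + 1) = _
      omega

/-- Index types of the trivial resolution. -/
def trivι : ℕ → Type
  | 0 => Unit
  | _ + 1 => Empty

instance trivFin : ∀ i, Fintype (trivι i)
  | 0 => inferInstanceAs (Fintype Unit)
  | _ + 1 => inferInstanceAs (Fintype Empty)

instance trivDec : ∀ i, DecidableEq (trivι i)
  | 0 => inferInstanceAs (DecidableEq Unit)
  | _ + 1 => inferInstanceAs (DecidableEq Empty)

noncomputable def trivRes : GRes k σ ⊥ where
  ι := trivι
  fin := trivFin
  dec := trivDec
  deg _ _ := 0
  d _ := 0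
  o := ()
  ho := fun _ => rfl
  deg_o := rfl
  exact_zero := by
    intro w
    rw [Ideal.mem_bot]
    constructor
    · intro h
      exact ⟨0, by funext l; exact h.symm⟩
    · rintro ⟨a, rfl⟩
      rfl
  exact_succ := by
    intro i x
    constructor
    · intro _
      exact ⟨0, by funext l; exact Empty.elim l⟩
    · intro _
      rfl
  homog := fun _ j => Empty.elim j
  minimal := fun _ j => Empty.elim j

theorem Rg_bot : Rg (⊥ : Ideal (MvPolynomial σ k)) 0 :=
  ⟨trivRes, fun _ _ => Nat.zero_le _, 0, (), rfl⟩

end cone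

section comb
variable {k : Type} [Field k] {n : ℕ}

/-- Exponent vector of the monomial `x_a ⋯ x_{a+l-1}`. -/
noncomputable def pe (n a l : ℕ) : Fin n →₀ ℕ :=
  Finsupp.equivFunOnFinite.symm (fun i => if a ≤ (i : ℕ) ∧ (i : ℕ) < a + l then 1 else 0)

theorem pe_apply (a l : ℕ) (i : Fin n) :
    pe n a l i = if a ≤ (i : ℕ) ∧ (i : ℕ) < a + l then 1 else 0 := rfl

theorem pe_right (a l : ℕ) (h : a + l < n) :
    pe n a (l + 1) = Finsupp.single ⟨a + l, h⟩ 1 + pe n a l := by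
  ext i
  rw [Finsupp.add_apply, pe_apply, pe_apply, Finsupp.single_apply]
  simp only [Fin.ext_iff]
  split_ifs <;> omega

theorem pe_left (a l : ℕ) (h : a < n) :
    pe n a (l + 1) = pe n (a + 1) l + Finsupp.single ⟨a, h⟩ 1 := by
  ext i
  rw [Finsupp.add_apply, pe_apply, pe_apply, Finsupp.single_apply]
  simp only [Fin.ext_iff]
  split_ifs <;> omega

theorem pe_degree (a l : ℕ) (h : a + l ≤ n) : (pe n a l).degree = l := by
  induction l with
  | zero =>
    have : pe n a 0 = 0 := by
      ext i
      rw [pe_apply, if_neg (by omega)]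
      rfl
    rw [this, map_zero]
  | succ l ih => rw [pe_right a l (by omega), map_add, ih (by omega), Finsupp.degree_single]; omega

/-- Monomial ideals. -/
noncomputable def MI (k : Type) [Field k] {n : ℕ} (S : Set (Fin n →₀ ℕ)) :
    Ideal (MvPolynomial (Fin n) k) :=
  Ideal.span ((fun s => monomial s (1 : k)) '' S)

theorem mem_MI (S : Set (Fin n →₀ ℕ)) (p : MvPolynomial (Fin n) k) :
    p ∈ MI k S ↔ ∀ e ∈ p.support, ∃ s ∈ S, s ≤ e := mem_ideal_span_monomial_image

theorem MI_insert (S : Set (Fin n →₀ ℕ)) (u : Fin n →₀ ℕ) :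
    MI k (insert u S) = MI k S ⊔ Ideal.span {monomial u (1 : k)} := by
  unfold MI
  rw [Set.image_insert_eq, Ideal.span_insert, sup_comm]

theorem MI_colon (S S' : Set (Fin n →₀ ℕ)) (u : Fin n →₀ ℕ)
    (h : ∀ e, ∀ s ∈ S, s ≤ u + e → ∃ s' ∈ S', s' ≤ e) (p : MvPolynomial (Fin n) k)
    (hp : monomial u 1 * p ∈ MI k S) : p ∈ MI k S' := by
  rw [mem_MI] at hp ⊢
  intro e he
  obtain ⟨s, hs, hs'⟩ := hp (u + e) (by
    rw [mem_support_iff] at he ⊢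
    rwa [coeff_monomial_mul, one_mul])
  exact h e s hs hs'

theorem MI_mul (S S' : Set (Fin n →₀ ℕ)) (u : Fin n →₀ ℕ)
    (h : ∀ s' ∈ S', ∃ s ∈ S, s ≤ u + s') (p : MvPolynomial (Fin n) k)
    (hp : p ∈ MI k S') : monomial u 1 * p ∈ MI k S := by
  rw [mem_MI] at hp ⊢
  intro e he
  rw [mem_support_iff, coeff_monomial_mul'] at he
  split_ifs at he with h1
  · rw [one_mul, ← mem_support_iff] at he
    obtain ⟨s', hs', h2⟩ := hp _ he
    obtain ⟨s, hs, h3⟩ := h s' hs'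
    refine ⟨s, hs, h3.trans ?_⟩
    calc u + s' ≤ u + (e - u) := add_le_add_right h2 u
      _ = e := add_tsub_cancel_of_le h1
  · exact absurd rfl he

/-- Exponents of the generators of the path ideal on the first `m` vertices. -/
def PS (n t m : ℕ) : Set (Fin n →₀ ℕ) := {e | ∃ a, a + t ≤ m ∧ e = pe n a t}

theorem PS_succ (t m : ℕ) (h : t ≤ m + 1) :
    PS n t (m + 1) = insert (pe n (m + 1 - t) t) (PS n t m) := by
  ext e
  simp only [PS, Set.mem_insert_iff, Set.mem_ofPred_eq]
  constructor
  · rintro ⟨a, ha, rfl⟩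
    by_cases h1 : a + t ≤ m
    · exact Or.inr ⟨a, h1, rfl⟩
    · left
      congr 1
      omega
  · rintro (rfl | ⟨a, ha, rfl⟩)
    · exact ⟨m + 1 - t, by omega, rfl⟩
    · exact ⟨a, by omega, rfl⟩

theorem pe_le_iff (a t : ℕ) (e : Fin n →₀ ℕ) :
    pe n a t ≤ e ↔ ∀ i : Fin n, a ≤ (i : ℕ) → (i : ℕ) < a + t → 1 ≤ e i := by
  rw [Finsupp.le_def]
  apply forall_congr'
  intro i
  rw [pe_apply]
  split_ifs with h
  · exact ⟨fun h1 _ _ => h1, fun h1 => h1 h.1 h.2⟩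
  · exact ⟨fun _ h1 h2 => absurd ⟨h1, h2⟩ h, fun _ => Nat.zero_le _⟩

theorem MI_empty : MI k (∅ : Set (Fin n →₀ ℕ)) = ⊥ := by
  simp [MI]

theorem single_le {v : Fin n} {e : Fin n →₀ ℕ} (h : 1 ≤ e v) : Finsupp.single v 1 ≤ e := by
  rw [Finsupp.le_def]
  intro i
  rw [Finsupp.single_apply]
  split_ifs with h1
  · rw [← h1]; exact h
  · exact Nat.zero_le _

theorem Rg_path (t : ℕ) (ht : 2 ≤ t) : ∀ m, m ≤ n →
    Rg (MI k (PS n t m)) ((t - 1) * ((m + 1) / (t + 1))) := by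
  intro m
  induction m using Nat.strong_induction_on with
  | _ m ih =>
  intro hmn
  by_cases hmt : m < t
  · have h1 : PS n t m = ∅ := by
      ext e
      simp only [PS, Set.mem_ofPred_eq, Set.mem_empty_iff_false, iff_false]
      rintro ⟨a, ha, -⟩
      omega
    rw [h1, MI_empty, Nat.div_eq_of_lt (by omega), mul_zero]
    exact Rg_bot
  obtain ⟨m, rfl⟩ : ∃ m', m = m' + 1 := ⟨m - 1, by omega⟩
  obtain ⟨l, rfl⟩ : ∃ l, t = l + 1 := ⟨t - 1, by omega⟩
  have hprev := ih m (by omega) (by omega)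
  have hX : monomial (pe n (m + 1 - (l + 1)) (l + 1)) (1 : k) =
      X (⟨m - l + l, by omega⟩ : Fin n) * monomial (pe n (m - l) l) (1 : k) := by
    rw [show m + 1 - (l + 1) = m - l by omega, pe_right _ _ (by omega), X, monomial_mul, one_mul]
  rw [PS_succ _ _ (by omega), MI_insert, hX]
  have hX' : ∀ p : MvPolynomial (Fin n) k,
      X (⟨m - l + l, by omega⟩ : Fin n) * monomial (pe n (m - l) l) (1 : k) * p =
      monomial (pe n (m - l) (l + 1)) (1 : k) * p := by
    intro p
    rw [← hX, show m + 1 - (l + 1) = m - l by omega]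
  have hdeg : (monomial (pe n (m - l) l) (1 : k)).IsHomogeneous l :=
    isHomogeneous_monomial _ (pe_degree _ _ (by omega))
  by_cases hml : m = l
  · have h1 := Rg_cone hprev (Rg_bot (k := k) (σ := Fin n)) ⟨m - l + l, by omega⟩ _ l hdeg
      (by
        intro p hp
        rw [Ideal.mem_bot] at hp
        rw [hp, mul_zero]
        exact Submodule.zero_mem _)
      (by
        intro p hp
        rw [hX'] at hp
        rw [← MI_empty]
        refine MI_colon _ _ _ ?_ p hp
        rintro e s ⟨a, ha, rfl⟩
        omega)
    convert h1 using 1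
    have e1 : (m + 1 + 1) / (l + 1 + 1) = 1 := by
      rw [hml]; exact Nat.div_self (by omega)
    have e2 : (m + 1) / (l + 1 + 1) = 0 := Nat.div_eq_of_lt (by omega)
    rw [e1, e2]
    simp
  · -- the colon ideal
    obtain ⟨s, hs⟩ : ∃ s, m = s + l + 1 := ⟨m - l - 1, by omega⟩
    have hms : m - l = s + 1 := by omega
    have hJ0 := ih s (by omega) (by omega)
    have hJ := Rg_cone hJ0 hJ0 (⟨s, by omega⟩ : Fin n) 1 0 (isHomogeneous_one _ _)
      (fun p hp => by rwa [one_mul])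
      (by
        intro p hp
        rw [mul_one, X] at hp
        refine MI_colon _ _ _ ?_ p hp
        rintro e _ ⟨a, ha, rfl⟩ h
        refine ⟨_, ⟨a, ha, rfl⟩, ?_⟩
        rw [pe_le_iff] at h ⊢
        intro i h1 h2
        have h3 := h i h1 h2
        rw [Finsupp.add_apply, Finsupp.single_apply, if_neg, zero_add] at h3
        · exact h3
        · rw [Fin.ext_iff]
          simp only
          omega)
    rw [mul_one, X, ← MI_insert, add_zero, max_self] at hJ
    have h1 := Rg_cone hprev hJ ⟨m - l + l, by omega⟩ _ l hdeg
      (by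
        intro p hp
        refine MI_mul _ _ _ ?_ p hp
        rintro s' (rfl | ⟨a, ha, rfl⟩)
        · refine ⟨_, ⟨s, by omega, rfl⟩, ?_⟩
          rw [pe_left s l (by omega), hms]
        · exact ⟨_, ⟨a, by omega, rfl⟩, le_add_self⟩)
      (by
        intro p hp
        rw [hX'] at hp
        refine MI_colon _ _ _ ?_ p hp
        rintro e _ ⟨a, ha, rfl⟩ h
        rw [pe_le_iff] at h
        by_cases hc : a + (l + 1) ≤ s
        · refine ⟨_, Or.inr ⟨a, hc, rfl⟩, ?_⟩
          rw [pe_le_iff]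
          intro i h1 h2
          have h3 := h i h1 h2
          rwa [Finsupp.add_apply, pe_apply, if_neg (by omega), zero_add] at h3
        · refine ⟨_, Or.inl rfl, ?_⟩
          have h3 := h ⟨s, by omega⟩ (by simp only; omega) (by simp only; omega)
          rw [Finsupp.add_apply, pe_apply, if_neg (by simp only; omega), zero_add] at h3
          exact single_le h3)
    convert h1 using 1
    have e1 : (m + 1 + 1) / (l + 1 + 1) = (s + 1) / (l + 1 + 1) + 1 := by
      rw [← Nat.add_div_right _ (by omega)]
      congr 1
      omega
    have e2 : (m + 1) / (l + 1 + 1) ≤ (s + 1) / (l + 1 + 1) + 1 := by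
      rw [← e1]
      exact Nat.div_le_div_right (by omega)
    rw [e1, max_eq_right]
    · simp [mul_add]
    · calc (l + 1 - 1) * ((m + 1) / (l + 1 + 1))
          ≤ (l + 1 - 1) * ((s + 1) / (l + 1 + 1) + 1) := Nat.mul_le_mul_left _ e2
        _ = _ := by simp [mul_add]

theorem iter_parent (T : RTree (Fin n)) (hpar : ∀ v : Fin n, (T.parent v : ℕ) = (v : ℕ) - 1)
    (j : ℕ) (v : Fin n) : ((T.parent^[j] v : Fin n) : ℕ) = (v : ℕ) - j := by
  induction j with
  | zero => rfl
  | succ j ih => rw [Function.iterate_succ_apply', hpar, ih]; omega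

theorem root_val (T : RTree (Fin n)) (hpar : ∀ v : Fin n, (T.parent v : ℕ) = (v : ℕ) - 1) :
    (T.root : ℕ) = 0 := by
  have := hpar T.root
  rw [T.parent_root] at this
  omega

theorem level_eq (T : RTree (Fin n)) (hpar : ∀ v : Fin n, (T.parent v : ℕ) = (v : ℕ) - 1)
    (v : Fin n) : T.level v = (v : ℕ) := by
  unfold RTree.level
  rw [Nat.find_eq_iff]
  simp only [Fin.ext_iff, iter_parent T hpar, root_val T hpar]
  constructor
  · omega
  · intro m hm
    omega

theorem pathMonomial_eq (T : RTree (Fin n))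
    (hpar : ∀ v : Fin n, (T.parent v : ℕ) = (v : ℕ) - 1) (v : Fin n) (t : ℕ)
    (ht : t ≤ (v : ℕ) + 1) :
    T.pathMonomial k t v = monomial (pe n ((v : ℕ) + 1 - t) t) 1 := by
  unfold RTree.pathMonomial
  induction t with
  | zero =>
    have : pe n ((v : ℕ) + 1 - 0) 0 = 0 := by
      ext i
      rw [pe_apply, if_neg (by omega)]
      rfl
    rw [this]
    simp
  | succ t ih =>
    have hv := v.2
    rw [Finset.prod_range_succ, ih (by omega), pe_left _ _ (by omega),
      show (v : ℕ) + 1 - (t + 1) + 1 = (v : ℕ) + 1 - t by omega, X, monomial_mul, one_mul]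
    congr 4
    rw [Fin.ext_iff, iter_parent T hpar]
    simp only
    omega

theorem pathIdeal_eq (T : RTree (Fin n))
    (hpar : ∀ v : Fin n, (T.parent v : ℕ) = (v : ℕ) - 1) (t : ℕ) (ht : 1 ≤ t) :
    T.pathIdeal k t = MI k (PS n t n) := by
  unfold RTree.pathIdeal MI
  congr 1
  ext p
  simp only [Set.mem_ofPred_eq, Set.mem_image, PS]
  constructor
  · rintro ⟨v, hv, rfl⟩
    rw [level_eq T hpar] at hv
    have := v.2
    exact ⟨_, ⟨(v : ℕ) + 1 - t, by omega, rfl⟩, (pathMonomial_eq T hpar v t hv).symm⟩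
  · rintro ⟨_, ⟨a, ha, rfl⟩, rfl⟩
    refine ⟨⟨a + t - 1, by omega⟩, ?_, ?_⟩
    · rw [level_eq T hpar]
      simp only
      omega
    · rw [pathMonomial_eq T hpar _ t (by simp only; omega)]
      have : a + t - 1 + 1 - t = a := by omega
      simp only [this]

end comb
end PathReg

/-- [BRT, Corollary 5.4]: for the directed path `P_n` on `n` vertices and `2 ≤ t ≤ n`,
`reg(R/I_t(P_n)) = (t-1)·⌈(n-t+1)/(t+1)⌉`. -/
theorem reg_path_ideal_directed_path
    {k : Type} [Field k] {n : ℕ} (T : RTree (Fin n))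
    (hpar : ∀ v : Fin n, (T.parent v : ℕ) = (v : ℕ) - 1)
    (t : ℕ) (ht1 : 2 ≤ t) (ht2 : t ≤ n) :
    reg k (Fin n) (T.pathIdeal k t) =
      (((t - 1) * ((n - t + 1 + t) / (t + 1)) : ℕ) : ℤ) := by
  rw [PathReg.pathIdeal_eq T hpar t (by omega),
    (PathReg.Rg_path (k := k) (n := n) t ht1 n le_rfl).reg_eq]
  congr 3
  omega
end
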